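/- Let x and y be generic 4×4 matrices. The traces of the following 32 matrices form a minimal generating set of the K-algebra C_{4,2} (they generate C_{4,2} as a unital K-algebra, and no proper subset of them does): x, y, x², xy, y², x³, x²y, xy², y³, x⁴, x³y, x²y², xy³, y⁴, xyxy, (x²y)², (y²x)², x³y², y³x², x²y²xy, y²x²yx, x³y²xy, y³x²yx, x³y²x²y, y³x²y²x, x³y³xy, y³x³yx, x³yx²yxy, x²y²xyx²y, y²x²yxy²x, y³xy²xyx, x³y³x²y². -/

import Mathlib

open MvPolynomial Matrix

noncomputable section

/-- Index type for the entries of a pair of generic `n × n` matrices: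
`Sum.inl (i,j)` indexes the `(i,j)` entry of `x`, `Sum.inr (i,j)` that of `y`. -/
abbrev MatVar (n : ℕ) := (Fin n × Fin n) ⊕ (Fin n × Fin n)

/-- The substitution sending the variables to the entries of the pair `(A, B)`. -/
def pairSub {K : Type*} [CommSemiring K] {n : ℕ} (A B : Matrix (Fin n) (Fin n) K) :
    MatVar n → K
  | Sum.inl ij => A ij.1 ij.2
  | Sum.inr ij => B ij.1 ij.2

/-- A polynomial function on pairs of `n × n` matrices is `GLₙ`-invariant (for the action
by simultaneous conjugation). -/
def IsMatInvariant {K : Type*} [Field K] {n : ℕ} (f : MvPolynomial (MatVar n) K) : Prop :=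
  ∀ (a : GL (Fin n) K) (A B : Matrix (Fin n) (Fin n) K),
    MvPolynomial.eval
        (pairSub ((a : Matrix (Fin n) (Fin n) K) * A * ((a⁻¹ : GL (Fin n) K) : Matrix (Fin n) (Fin n) K))
          ((a : Matrix (Fin n) (Fin n) K) * B * ((a⁻¹ : GL (Fin n) K) : Matrix (Fin n) (Fin n) K))) f =
      MvPolynomial.eval (pairSub A B) f

/-- The weight giving the bidegree: entries of `x` have weight `(1,0)`,
those of `y` have weight `(0,1)`. -/
def bideg (n : ℕ) : MatVar n → ℕ × ℕ
  | Sum.inl _ => (1, 0)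
  | Sum.inr _ => (0, 1)

/-- The bigraded component of bidegree `(p, q)` of the pure trace algebra `C_{n,2}`. -/
def pureComponent (K : Type*) [Field K] (n p q : ℕ) : Set (MvPolynomial (MatVar n) K) :=
  {f | IsMatInvariant f ∧ f.IsWeightedHomogeneous (bideg n) (p, q)}

/-- `dim_K C_{n,2}^{(p,q)}`. -/
def pureDim (K : Type*) [Field K] (n p q : ℕ) : ℕ :=
  Set.finrank K (pureComponent K n p q)

/-- The bigraded Poincaré series `P(C_{n,2}; s, t)`, with `s` the variable `X 0` and
`t` the variable `X 1`. -/
def purePS2 (K : Type*) [Field K] (n : ℕ) : MvPowerSeries (Fin 2) ℚ :=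
  fun d => (pureDim K n (d 0) (d 1) : ℚ)

/-- abbreviation for the power series variable `s`. -/
def ps : MvPowerSeries (Fin 2) ℚ := MvPowerSeries.X 0

/-- abbreviation for the power series variable `t`. -/
def pt : MvPowerSeries (Fin 2) ℚ := MvPowerSeries.X 1


/-- The pure trace algebra `C_{n,2}`: the subalgebra of `GLₙ`-invariant polynomial
functions on pairs of `n × n` matrices. -/
def pureAlg (K : Type*) [Field K] (n : ℕ) : Subalgebra K (MvPolynomial (MatVar n) K) where
  carrier := {f | IsMatInvariant f}
  mul_mem' := fun hf hg a A B => by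
    simp only [_root_.map_mul]
    rw [hf a A B, hg a A B]
  add_mem' := fun hf hg a A B => by
    simp only [_root_.map_add]
    rw [hf a A B, hg a A B]
  algebraMap_mem' := fun c a A B => by
    simp [MvPolynomial.algebraMap_eq]

/-- The generic matrix `x`, whose entries are the corresponding polynomial variables. -/
def genX (K : Type*) [Field K] (n : ℕ) :
    Matrix (Fin n) (Fin n) (MvPolynomial (MatVar n) K) :=
  Matrix.of fun i j => MvPolynomial.X (Sum.inl (i, j))

/-- The generic matrix `y`, whose entries are the corresponding polynomial variables. -/
def genY (K : Type*) [Field K] (n : ℕ) :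
    Matrix (Fin n) (Fin n) (MvPolynomial (MatVar n) K) :=
  Matrix.of fun i j => MvPolynomial.X (Sum.inr (i, j))

/-- The traces of the 32 words
`x, y, x², xy, y², x³, x²y, xy², y³, x⁴, x³y, x²y², xy³, y⁴, xyxy, (x²y)², (y²x)²,
x³y², y³x², x²y²xy, y²x²yx, x³y²xy, y³x²yx, x³y²x²y, y³x²y²x, x³y³xy, y³x³yx,
x³yx²yxy, x²y²xyx²y, y²x²yxy²x, y³xy²xyx, x³y³x²y²`
in the generic `4 × 4` matrices `x`, `y`. -/
def gens32 (K : Type*) [Field K] : Fin 32 → MvPolynomial (MatVar 4) K :=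
  let x := genX K 4
  let y := genY K 4
  ![(x).trace, (y).trace,
    (x ^ 2).trace, (x * y).trace, (y ^ 2).trace,
    (x ^ 3).trace, (x ^ 2 * y).trace, (x * y ^ 2).trace, (y ^ 3).trace,
    (x ^ 4).trace, (x ^ 3 * y).trace, (x ^ 2 * y ^ 2).trace, (x * y ^ 3).trace,
    (y ^ 4).trace, (x * y * x * y).trace, ((x ^ 2 * y) ^ 2).trace, ((y ^ 2 * x) ^ 2).trace,
    (x ^ 3 * y ^ 2).trace, (y ^ 3 * x ^ 2).trace,
    (x ^ 2 * y ^ 2 * x * y).trace, (y ^ 2 * x ^ 2 * y * x).trace,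
    (x ^ 3 * y ^ 2 * x * y).trace, (y ^ 3 * x ^ 2 * y * x).trace,
    (x ^ 3 * y ^ 2 * x ^ 2 * y).trace, (y ^ 3 * x ^ 2 * y ^ 2 * x).trace,
    (x ^ 3 * y ^ 3 * x * y).trace, (y ^ 3 * x ^ 3 * y * x).trace,
    (x ^ 3 * y * x ^ 2 * y * x * y).trace, (x ^ 2 * y ^ 2 * x * y * x ^ 2 * y).trace,
    (y ^ 2 * x ^ 2 * y * x * y ^ 2 * x).trace, (y ^ 3 * x * y ^ 2 * x * y * x).trace,
    (x ^ 3 * y ^ 3 * x ^ 2 * y ^ 2).trace]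

/-- trace function attached to a permutation -/
def tperm {R : Type*} [CommRing R] {n m : ℕ} (σ : Equiv.Perm (Fin m))
    (A : Fin m → Matrix (Fin n) (Fin n) R) : R :=
  ∑ i : Fin m → Fin n, ∏ k, A k (i k) (i (σ k))

theorem tperm_zero {R : Type*} [CommRing R] {n m : ℕ} (e : Equiv.Perm (Fin m))
    (A : Fin (m+1) → Matrix (Fin n) (Fin n) R) :
    tperm (Equiv.Perm.decomposeFin.symm (0, e)) A = (A 0).trace * tperm e (Fin.tail A) := by
  unfold tperm
  rw [← (Fin.consEquiv (fun _ : Fin (m+1) => Fin n)).sum_comp, Fintype.sum_prod_type,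
    Matrix.trace, Finset.sum_mul]
  refine Finset.sum_congr rfl fun a _ => ?_
  rw [Finset.mul_sum]
  refine Finset.sum_congr rfl fun b _ => ?_
  rw [Fin.prod_univ_succ]
  simp [Fin.consEquiv, Fin.tail]

theorem tperm_succ {R : Type*} [CommRing R] {n m : ℕ} (e : Equiv.Perm (Fin m)) (j : Fin m)
    (A : Fin (m+1) → Matrix (Fin n) (Fin n) R) :
    tperm (Equiv.Perm.decomposeFin.symm ((e j).succ, e)) A =
      tperm e (Function.update (Fin.tail A) j (A j.succ * A 0)) := by
  unfold tperm
  rw [← (Fin.consEquiv (fun _ : Fin (m+1) => Fin n)).sum_comp, Fintype.sum_prod_type,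
    Finset.sum_comm]
  refine Finset.sum_congr rfl fun b _ => ?_
  rw [← Finset.mul_prod_erase _ _ (Finset.mem_univ j)]
  have h1 : ∀ k ∈ Finset.univ.erase j,
      Function.update (Fin.tail A) j (A j.succ * A 0) k (b k) (b (e k)) =
      A k.succ (b k) (b (e k)) := by
    intro k hk
    rw [Function.update_of_ne (Finset.ne_of_mem_erase hk)]; rfl
  rw [Finset.prod_congr rfl h1, Function.update_self, Matrix.mul_apply, Finset.sum_mul]
  refine Finset.sum_congr rfl fun a _ => ?_
  rw [Fin.prod_univ_succ, ← Finset.mul_prod_erase _ _ (Finset.mem_univ j)]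
  have h2 : ∀ k ∈ Finset.univ.erase j,
      A k.succ ((Fin.consEquiv (fun _ : Fin (m+1) => Fin n)) (a, b) k.succ)
        ((Fin.consEquiv (fun _ : Fin (m+1) => Fin n)) (a, b)
          (Equiv.Perm.decomposeFin.symm ((e j).succ, e) k.succ)) =
      A k.succ (b k) (b (e k)) := by
    intro k hk
    have : e k ≠ e j := fun h => Finset.ne_of_mem_erase hk (e.injective h)
    rw [Equiv.Perm.decomposeFin_symm_apply_succ, Equiv.swap_apply_of_ne_of_ne
      (Fin.succ_ne_zero _) (fun h => this (Fin.succ_injective _ h))]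
    simp [Fin.consEquiv]
  rw [Finset.prod_congr rfl h2]
  simp [Fin.consEquiv]
  ring

/-- alternating sum -/
def altD {R : Type*} [CommRing R] {n m : ℕ} (A : Fin m → Matrix (Fin n) (Fin n) R) : R :=
  ∑ σ : Equiv.Perm (Fin m), ((Equiv.Perm.sign σ : ℤ) : R) * tperm σ A

theorem altD_eq_zero {R : Type*} [CommRing R] {n m : ℕ} (h : n < m)
    (A : Fin m → Matrix (Fin n) (Fin n) R) : altD A = 0 := by
  unfold altD tperm
  simp_rw [Finset.mul_sum]
  rw [Finset.sum_comm]
  refine Finset.sum_eq_zero fun i _ => ?_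
  obtain ⟨x, y, hxy, hi⟩ := Fintype.exists_ne_map_eq_of_card_lt i (by simpa using h)
  have := Matrix.det_zero_of_column_eq (M := Matrix.of fun k j => A k (i k) (i j)) hxy
    (by intro k; simp [hi])
  rw [← Matrix.det_transpose, Matrix.det_apply'] at this
  simpa using this

theorem altD_succ {R : Type*} [CommRing R] {n m : ℕ}
    (A : Fin (m+1) → Matrix (Fin n) (Fin n) R) :
    altD A = (A 0).trace * altD (Fin.tail A) -
      ∑ j : Fin m, altD (Function.update (Fin.tail A) j (A j.succ * A 0)) := by
  unfold altD
  rw [← (Equiv.Perm.decomposeFin (n := m)).symm.sum_comp, Fintype.sum_prod_type,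
    Fin.sum_univ_succ]
  simp only [tperm_zero, Equiv.Perm.decomposeFin.symm_sign]
  rw [sub_eq_add_neg, Finset.mul_sum]
  congr 1
  · refine Finset.sum_congr rfl fun e _ => ?_
    simp; ring
  · rw [Finset.sum_comm, Finset.sum_comm (γ := Fin m), ← Finset.sum_neg_distrib]
    refine Finset.sum_congr rfl fun e _ => ?_
    rw [← Equiv.sum_comp e, ← Finset.sum_neg_distrib]
    refine Finset.sum_congr rfl fun j _ => ?_
    rw [tperm_succ]
    simp [Fin.succ_ne_zero]

theorem altD_zero {R : Type*} [CommRing R] {n : ℕ}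
    (A : Fin 0 → Matrix (Fin n) (Fin n) R) : altD A = 1 := by
  simp [altD, tperm]

/-- product of a word -/
def wd {R : Type*} [CommRing R] {n : ℕ} (X Y : Matrix (Fin n) (Fin n) R) (w : List Bool) :
    Matrix (Fin n) (Fin n) R :=
  (w.map (fun b => if b then Y else X)).prod

theorem wd_append {R : Type*} [CommRing R] {n : ℕ} (X Y : Matrix (Fin n) (Fin n) R)
    (u v : List Bool) : wd X Y (u ++ v) = wd X Y u * wd X Y v := by
  simp [wd]

theorem tperm_mem {R : Type*} [CommRing R] {K : Type*} [CommRing K] [Algebra K R] {n : ℕ}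
    (X Y : Matrix (Fin n) (Fin n) R) (S : Subalgebra K R)
    (hS : ∀ w, (wd X Y w).trace ∈ S) :
    ∀ (m : ℕ) (σ : Equiv.Perm (Fin m)) (w : Fin m → List Bool),
      tperm σ (fun k => wd X Y (w k)) ∈ S := by
  intro m
  induction m with
  | zero => intro σ w; simp [tperm, S.one_mem]
  | succ m ih =>
    intro σ w
    obtain ⟨⟨p, e⟩, rfl⟩ := Equiv.Perm.decomposeFin.symm.surjective σ
    induction p using Fin.cases with
    | zero =>
      rw [tperm_zero]
      exact S.mul_mem (hS _) (ih e (fun k => w k.succ))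
    | succ k =>
      obtain ⟨j, rfl⟩ := e.surjective k
      rw [tperm_succ]
      have : Function.update (Fin.tail fun k => wd X Y (w k)) j
          (wd X Y (w j.succ) * wd X Y (w 0)) =
          fun k => wd X Y (Function.update (fun k : Fin m => w k.succ) j (w j.succ ++ w 0) k) := by
        funext k
        by_cases h : k = j
        · subst h; simp [wd_append]
        · simp [h, Fin.tail]
      rw [this]
      exact ih e _


/-- the symmetrised sum over the 24 arrangements -/
def symSum {W : Type*} [AddCommGroup W] (L : List Bool → W) (a b c e z : List Bool) : W :=
    L (z ++ a ++ b ++ c ++ e) +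
    L (z ++ a ++ b ++ e ++ c) +
    L (z ++ a ++ c ++ b ++ e) +
    L (z ++ a ++ c ++ e ++ b) +
    L (z ++ a ++ e ++ b ++ c) +
    L (z ++ a ++ e ++ c ++ b) +
    L (z ++ b ++ a ++ c ++ e) +
    L (z ++ b ++ a ++ e ++ c) +
    L (z ++ b ++ c ++ a ++ e) +
    L (z ++ b ++ c ++ e ++ a) +
    L (z ++ b ++ e ++ a ++ c) +
    L (z ++ b ++ e ++ c ++ a) +
    L (z ++ c ++ a ++ b ++ e) +
    L (z ++ c ++ a ++ e ++ b) +
    L (z ++ c ++ b ++ a ++ e) +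
    L (z ++ c ++ b ++ e ++ a) +
    L (z ++ c ++ e ++ a ++ b) +
    L (z ++ c ++ e ++ b ++ a) +
    L (z ++ e ++ a ++ b ++ c) +
    L (z ++ e ++ a ++ c ++ b) +
    L (z ++ e ++ b ++ a ++ c) +
    L (z ++ e ++ b ++ c ++ a) +
    L (z ++ e ++ c ++ a ++ b) +
    L (z ++ e ++ c ++ b ++ a)

theorem upd2 {α : Type*} (a b v : α) (j : Fin 2) : Function.update ![a, b] j v =
    ![if j = 0 then v else a, if j = 1 then v else b] := by
  ext i; fin_cases j <;> fin_cases i <;> simp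
theorem upd1 {α : Type*} (a v : α) (j : Fin 1) : Function.update ![a] j v = ![v] := by
  ext i; fin_cases j; fin_cases i; simp
theorem upd3 {α : Type*} (a b c v : α) (j : Fin 3) : Function.update ![a, b, c] j v =
    ![if j = 0 then v else a, if j = 1 then v else b, if j = 2 then v else c] := by
  ext i; fin_cases j <;> fin_cases i <;> simp
theorem upd4 {α : Type*} (a b c d v : α) (j : Fin 4) : Function.update ![a, b, c, d] j v =
    ![if j = 0 then v else a, if j = 1 then v else b, if j = 2 then v else c,
      if j = 3 then v else d] := by
  ext i; fin_cases j <;> fin_cases i <;> simp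

theorem altD_wd_succ {R : Type*} [CommRing R] {n m : ℕ} (X Y : Matrix (Fin n) (Fin n) R)
    (w : Fin (m+1) → List Bool) :
    altD (fun k => wd X Y (w k)) = (wd X Y (w 0)).trace * altD (fun k => wd X Y (Fin.tail w k)) -
      ∑ j : Fin m, altD (fun k => wd X Y
        (Function.update (Fin.tail w) j (w j.succ ++ w 0) k)) := by
  rw [altD_succ]
  congr 1
  refine Finset.sum_congr rfl fun j _ => ?_
  congr 1
  funext k
  by_cases h : k = j
  · subst h; simp [wd_append]
  · simp [h, Fin.tail]

theorem sum_update_len {m : ℕ} (w : Fin (m+1) → List Bool) (j : Fin m) :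
    ∑ k, (Function.update (Fin.tail w) j (w j.succ ++ w 0) k).length = ∑ k, (w k).length := by
  rw [Fin.sum_univ_succ, ← Finset.add_sum_erase _ _ (Finset.mem_univ j),
    ← Finset.add_sum_erase _ (fun k : Fin m => (w k.succ).length) (Finset.mem_univ j)]
  have : ∀ k ∈ Finset.univ.erase j,
      (Function.update (Fin.tail w) j (w j.succ ++ w 0) k).length = (w k.succ).length := by
    intro k hk
    rw [Function.update_of_ne (Finset.ne_of_mem_erase hk)]; rfl
  rw [Finset.sum_congr rfl this]
  simp; ring

theorem altD_mem {R : Type*} [CommRing R] {K : Type*} [CommRing K] [Algebra K R] {n : ℕ}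
    (X Y : Matrix (Fin n) (Fin n) R) (S : Subalgebra K R) (d : ℕ)
    (hS : ∀ w : List Bool, w.length < d → (wd X Y w).trace ∈ S) :
    ∀ (m : ℕ) (w : Fin m → List Bool), ∑ k, (w k).length < d →
      altD (fun k => wd X Y (w k)) ∈ S := by
  intro m
  induction m with
  | zero => intro w _; rw [altD_zero]; exact S.one_mem
  | succ m ih =>
    intro w hw
    rw [altD_wd_succ]
    have h0 := hw
    rw [Fin.sum_univ_succ] at h0
    refine S.sub_mem (S.mul_mem (hS _ (by omega)) (ih _ ?_)) (S.sum_mem fun j _ => ih _ ?_)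
    · simp only [Fin.tail]; omega
    · rw [sum_update_len]; exact hw

theorem altD_quot {R : Type*} [CommRing R] {K : Type*} [CommRing K] [Algebra K R] {n : ℕ}
    (X Y : Matrix (Fin n) (Fin n) R) (S : Subalgebra K R) (d : ℕ)
    (hS : ∀ w : List Bool, w.length < d → (wd X Y w).trace ∈ S)
    {m : ℕ} (w : Fin (m+1) → List Bool) (hw : ∑ k, (w k).length = d) (h0 : w 0 ≠ [])
    (h1 : 0 < ∑ k : Fin m, (w k.succ).length) :
    (Submodule.Quotient.mk (altD (fun k => wd X Y (w k))) : R ⧸ Subalgebra.toSubmodule S) =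
     - ∑ j : Fin m, Submodule.Quotient.mk (altD (fun k => wd X Y
        (Function.update (Fin.tail w) j (w j.succ ++ w 0) k))) := by
  rw [altD_wd_succ, Submodule.Quotient.mk_sub]
  have h0' := List.length_pos_iff.2 h0
  rw [Fin.sum_univ_succ] at hw
  have : (wd X Y (w 0)).trace * altD (fun k => wd X Y (Fin.tail w k)) ∈
      Subalgebra.toSubmodule S := by
    rw [Subalgebra.mem_toSubmodule]
    refine S.mul_mem (hS _ (by omega)) (altD_mem X Y S d hS _ _ ?_)
    simp only [Fin.tail]; omega
  rw [(Submodule.Quotient.mk_eq_zero _).2 this, zero_sub]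
  congr 1
  exact map_sum (Submodule.mkQ (Subalgebra.toSubmodule S)) _ _

theorem fti {R : Type*} [CommRing R] {K : Type*} [CommRing K] [Algebra K R]
    (X Y : Matrix (Fin 4) (Fin 4) R) (S : Subalgebra K R) (d : ℕ)
    (hS : ∀ w : List Bool, w.length < d → (wd X Y w).trace ∈ S)
    (a b c e z : List Bool) (ha : a ≠ []) (hb : b ≠ []) (hc : c ≠ []) (he : e ≠ []) (hz : z ≠ [])
    (hd : (z ++ a ++ b ++ c ++ e).length = d) :
    symSum (fun w => (Submodule.Quotient.mk ((wd X Y w).trace) : R ⧸ Subalgebra.toSubmodule S))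
      a b c e z = 0 := by
  have hz' := List.length_pos_iff.2 hz
  simp only [List.length_append] at hd
  let E : (m : ℕ) → (Fin m → List Bool) → R ⧸ Subalgebra.toSubmodule S := fun m w =>
    Submodule.Quotient.mk (altD (fun k => wd X Y (w k)))
  have E1 : ∀ u, E 1 ![u] = Submodule.Quotient.mk ((wd X Y u).trace) := by
    intro u
    simp only [E]
    rw [altD_succ]
    simp [altD_zero]
  have E2 : ∀ u v : List Bool, u ≠ [] → 0 < v.length → (u.length + v.length = d) →
      E 2 ![u, v] = - E 1 ![v ++ u] := by
    intro u v hu hv h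
    have := altD_quot X Y S d hS ![u, v] (by simpa using h) hu (by simpa using hv)
    simp only [Fin.sum_univ_succ, Fin.tail_def] at this
    refine this.trans ?_
    simp [E]
    congr 2; funext k; fin_cases k; simp
  have E3 : ∀ u v w : List Bool, u ≠ [] → v ≠ [] → 0 < w.length →
      (u.length + v.length + w.length = d) →
      E 3 ![u, v, w] = - (E 2 ![v ++ u, w] + E 2 ![v, w ++ u]) := by
    intro u v w hu hv hw h
    have := altD_quot X Y S d hS ![u, v, w] (by simp [Fin.sum_univ_succ]; omega) hu
      (by simp [Fin.sum_univ_succ]; omega)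
    refine this.trans ?_
    have ht : Fin.tail ![u, v, w] = ![v, w] := by funext k; fin_cases k <;> rfl
    simp only [ht, Fin.sum_univ_two, upd2]
    rfl
  have E4 : ∀ u v w t : List Bool, u ≠ [] → v ≠ [] → w ≠ [] → 0 < t.length →
      (u.length + v.length + w.length + t.length = d) →
      E 4 ![u, v, w, t] = - (E 3 ![v ++ u, w, t] + E 3 ![v, w ++ u, t] + E 3 ![v, w, t ++ u]) := by
    intro u v w t hu hv hw ht' h
    have := altD_quot X Y S d hS ![u, v, w, t] (by simp [Fin.sum_univ_succ]; omega) hu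
      (by simp [Fin.sum_univ_succ]; omega)
    refine this.trans ?_
    have ht : Fin.tail ![u, v, w, t] = ![v, w, t] := by funext k; fin_cases k <;> rfl
    simp only [ht, Fin.sum_univ_three, upd3]
    rfl
  have E5 : E 5 ![a, b, c, e, z] = - (E 4 ![b ++ a, c, e, z] + E 4 ![b, c ++ a, e, z] +
      E 4 ![b, c, e ++ a, z] + E 4 ![b, c, e, z ++ a]) := by
    have := altD_quot X Y S d hS ![a, b, c, e, z] (by simp [Fin.sum_univ_succ]; omega) ha
      (by simp [Fin.sum_univ_succ]; omega)
    refine this.trans ?_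
    have ht : Fin.tail ![a, b, c, e, z] = ![b, c, e, z] := by funext k; fin_cases k <;> rfl
    simp only [ht, Fin.sum_univ_four, upd4]
    rfl
  have h5 : E 5 ![a, b, c, e, z] = 0 := by
    simp only [E]
    rw [altD_eq_zero (by norm_num)]; rfl
  rw [← h5, E5]
  have ap : ∀ u v : List Bool, u ≠ [] → u ++ v ≠ [] := by intro u v h; simp [h]
  rw [E4 _ _ _ _ (ap _ _ hb) hc he hz' (by simp; omega),
    E4 _ _ _ _ hb (ap _ _ hc) he hz' (by simp; omega),
    E4 _ _ _ _ hb hc (ap _ _ he) hz' (by simp; omega),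
    E4 _ _ _ _ hb hc he (by simp; omega) (by simp; omega)]
  clear_value E
  iterate 12 rw [E3]
  iterate 24 rw [E2]
  · simp only [E1, symSum, List.append_assoc]
    abel
  all_goals first
    | assumption
    | (simp only [List.length_append]; omega)
    | (repeat apply ap
       assumption)

/-- decoding of words: bijective binary numeration -/
def dec : ℕ → List Bool
  | 0 => []
  | n + 1 => dec (n / 2) ++ [n % 2 == 1]
termination_by n => n
decreasing_by omega

theorem dec_zero : dec 0 = [] := by rw [dec]
theorem dec_odd (n : ℕ) (b : Bool) : dec (2 * n + 1 + b.toNat) = dec n ++ [b] := by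
  cases b
  · have : 2 * n + 1 + false.toNat = 2 * n + 1 := rfl
    rw [this, dec]
    have h1 : 2 * n / 2 = n := by omega
    have h2 : 2 * n % 2 = 0 := by omega
    rw [h1, h2]; rfl
  · have : 2 * n + 1 + true.toNat = (2 * n + 1) + 1 := rfl
    rw [this, dec]
    have h1 : (2 * n + 1) / 2 = n := by omega
    have h2 : (2 * n + 1) % 2 = 1 := by omega
    rw [h1, h2]; rfl

/-- sparse vectors: (coefficient, code) -/
abbrev Vc := List (ℕ × ℕ)
/-- rewriting tables -/
abbrev Env := List (List (ℕ × Vc))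

def vIns (c n : ℕ) : Vc → Vc
  | [] => [(c % 101, n)]
  | p :: t => bif Nat.beq n p.2 then ((c + p.1) % 101, n) :: t else p :: vIns c n t

def vAdd (c : ℕ) : Vc → Vc → Vc
  | [], w => w
  | p :: t, w => vIns (c * p.1) p.2 (vAdd c t w)

def vFind (n : ℕ) : List (ℕ × Vc) → Vc
  | [] => [(1, n)]
  | p :: t => bif Nat.beq n p.1 then p.2 else vFind n t

def vRed (env : Env) (n : ℕ) : Vc := vFind n (env.getD (Nat.log2 (n + 1)) [])

def vStep (env : Env) (b : Bool) : Vc → Vc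
  | [] => []
  | p :: t => vAdd p.1 (vRed env (2 * p.2 + 1 + b.toNat)) (vStep env b t)

def vApp (env : Env) : List Bool → Vc → Vc
  | [], v => v
  | b :: w, v => vApp env w (vStep env b v)

/-- relation instances -/
structure Inst where
  l : List Bool
  a : List Bool
  b : List Bool
  c : List Bool
  e : List Bool

def vRel (env : Env) (i : Inst) : Vc :=
  let P := fun (w : List Bool) (v : Vc) => vApp env w v
  let v := P i.l [(1, 0)]
  let A := P i.a v
  let B := P i.b v
  let C := P i.c v
  let D := P i.e v
  let AB := vAdd 1 (P i.b A) (P i.a B)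
  let AC := vAdd 1 (P i.c A) (P i.a C)
  let AD := vAdd 1 (P i.e A) (P i.a D)
  let BC := vAdd 1 (P i.c B) (P i.b C)
  let BD := vAdd 1 (P i.e B) (P i.b D)
  let CD := vAdd 1 (P i.e C) (P i.c D)
  let ABC := vAdd 1 (P i.c AB) (vAdd 1 (P i.b AC) (P i.a BC))
  let ABD := vAdd 1 (P i.e AB) (vAdd 1 (P i.b AD) (P i.a BD))
  let ACD := vAdd 1 (P i.e AC) (vAdd 1 (P i.c AD) (P i.a CD))
  let BCD := vAdd 1 (P i.e BC) (vAdd 1 (P i.c BD) (P i.b CD))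
  vAdd 1 (P i.e ABC) (vAdd 1 (P i.c ABD) (vAdd 1 (P i.b ACD) (P i.a BCD)))

def vZero : Vc → Bool
  | [] => true
  | p :: t => Nat.beq (p.1 % 101) 0 && vZero t

def vComb (R : List Vc) : List (ℕ × ℕ) → Vc
  | [] => []
  | p :: t => vAdd p.1 (R.getD p.2 []) (vComb R t)

/-- certificate of a rule -/
abbrev Crt := ℕ × Vc × List (ℕ × ℕ)

def chkRules (R : List Vc) : List Crt → Bool
  | [] => true
  | r :: t => vZero (vAdd 1 r.2.1 (vAdd 100 [(1, r.1)] (vComb R r.2.2))) && chkRules R t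

def rulesOf (l : List Crt) : List (ℕ × Vc) := l.map fun r => (r.1, r.2.1)

/-- trace vector of a word -/
def tApp (env : Env) : List Bool → Vc → Vc
  | [], v => v
  | [b], v => v.map fun p => (p.1, 2 * p.2 + 1 + b.toNat)
  | b :: b' :: w, v => tApp env (b' :: w) (vStep env b v)

def rotRow (env : Env) (r : Bool × List Bool) : Vc :=
  vAdd 1 (tApp env (r.1 :: r.2) [(1, 0)]) (vAdd 100 (tApp env (r.2 ++ [r.1]) [(1, 0)]) [])

def ev {W : Type*} [AddCommGroup W] (L : List Bool → W) (v : Vc) (z : List Bool) : W :=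
  (v.map fun p => p.1 • L (dec p.2 ++ z)).sum

theorem ev_nil {W : Type*} [AddCommGroup W] (L : List Bool → W) (z : List Bool) :
    ev L [] z = 0 := rfl
theorem ev_cons {W : Type*} [AddCommGroup W] (L : List Bool → W) (p : ℕ × ℕ) (v : Vc)
    (z : List Bool) : ev L (p :: v) z = p.1 • L (dec p.2 ++ z) + ev L v z := by simp [ev]

theorem mod_smul {W : Type*} [AddCommGroup W] (h101 : ∀ w : W, 101 • w = 0) (n : ℕ) (w : W) :
    (n % 101) • w = n • w := by
  conv_rhs => rw [← Nat.mod_add_div n 101, add_smul, mul_smul, h101, add_zero]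

theorem ev_ins {W : Type*} [AddCommGroup W] (L : List Bool → W) (h101 : ∀ w : W, 101 • w = 0)
    (c n : ℕ) (v : Vc) (z : List Bool) :
    ev L (vIns c n v) z = c • L (dec n ++ z) + ev L v z := by
  induction v with
  | nil => simp [vIns, ev, mod_smul h101]
  | cons p t ih =>
    rw [vIns]
    cases h : Nat.beq n p.2
    · simp only [cond_false, ev_cons, ih]; abel
    · have := Nat.eq_of_beq_eq_true h
      subst this
      simp only [cond_true, ev_cons, mod_smul h101, add_smul]; abel

theorem ev_add {W : Type*} [AddCommGroup W] (L : List Bool → W) (h101 : ∀ w : W, 101 • w = 0)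
    (c : ℕ) (v w : Vc) (z : List Bool) :
    ev L (vAdd c v w) z = c • ev L v z + ev L w z := by
  induction v with
  | nil => simp [vAdd, ev]
  | cons p t ih => rw [vAdd, ev_ins L h101, ih, ev_cons, smul_add, mul_smul, add_assoc]

/-- all rules in the environment are valid -/
def Sound {W : Type*} [AddCommGroup W] (L : List Bool → W) (env : Env) : Prop :=
  ∀ blk ∈ env, ∀ r ∈ blk, ∀ z, z ≠ [] → L (dec r.1 ++ z) = ev L r.2 z

theorem ev_find {W : Type*} [AddCommGroup W] (L : List Bool → W) (blk : List (ℕ × Vc))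
    (h : ∀ r ∈ blk, ∀ z, z ≠ [] → L (dec r.1 ++ z) = ev L r.2 z) (n : ℕ) (z : List Bool)
    (hz : z ≠ []) : ev L (vFind n blk) z = L (dec n ++ z) := by
  induction blk with
  | nil => simp [vFind, ev]
  | cons p t ih =>
    rw [vFind]
    cases hb : Nat.beq n p.1
    · exact ih fun r hr => h r (List.mem_cons_of_mem _ hr)
    · have := Nat.eq_of_beq_eq_true hb
      subst this
      exact (h p List.mem_cons_self z hz).symm

theorem ev_red {W : Type*} [AddCommGroup W] (L : List Bool → W) (env : Env) (hs : Sound L env)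
    (n : ℕ) (z : List Bool) (hz : z ≠ []) : ev L (vRed env n) z = L (dec n ++ z) := by
  refine ev_find L _ ?_ n z hz
  intro r hr
  rw [List.getD_eq_getElem?_getD] at hr
  cases h : env[Nat.log2 (n + 1)]? with
  | none => rw [h] at hr; simp at hr
  | some b =>
    rw [h] at hr
    exact hs b (List.mem_of_getElem? h) r hr

theorem ev_step {W : Type*} [AddCommGroup W] (L : List Bool → W) (h101 : ∀ w : W, 101 • w = 0)
    (env : Env) (hs : Sound L env) (b : Bool) (v : Vc) (z : List Bool) (hz : z ≠ []) :
    ev L (vStep env b v) z = ev L v (b :: z) := by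
  induction v with
  | nil => rfl
  | cons p t ih =>
    rw [vStep, ev_add L h101, ev_red L env hs _ z hz, ih, ev_cons, dec_odd]
    simp

theorem ev_app {W : Type*} [AddCommGroup W] (L : List Bool → W) (h101 : ∀ w : W, 101 • w = 0)
    (env : Env) (hs : Sound L env) (w : List Bool) (v : Vc) (z : List Bool) (hz : z ≠ []) :
    ev L (vApp env w v) z = ev L v (w ++ z) := by
  induction w generalizing v with
  | nil => rfl
  | cons b w ih =>
    rw [vApp, ih, ev_step L h101 env hs]
    · rfl
    · simp [hz]

theorem ev_rel {W : Type*} [AddCommGroup W] (L : List Bool → W) (h101 : ∀ w : W, 101 • w = 0)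
    (hc : ∀ u v, L (u ++ v) = L (v ++ u))
    (hsym : ∀ a b c e z, a ≠ [] → b ≠ [] → c ≠ [] → e ≠ [] → z ≠ [] → symSum L a b c e z = 0)
    (env : Env) (hs : Sound L env) (i : Inst)
    (hi : i.a ≠ [] ∧ i.b ≠ [] ∧ i.c ≠ [] ∧ i.e ≠ []) (z : List Bool) (hz : z ≠ []) :
    ev L (vRel env i) z = 0 := by
  have key : ∀ w v z, z ≠ [] → ev L (vApp env w v) z = ev L v (w ++ z) := fun w v z hz =>
    ev_app L h101 env hs w v z hz
  have hap : ∀ w : List Bool, w ++ z ≠ [] := by simp [hz]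
  have hap2 : ∀ w u : List Bool, w ++ (u ++ z) ≠ [] := by simp [hz]
  have hap3 : ∀ w u t : List Bool, w ++ (u ++ (t ++ z)) ≠ [] := by simp [hz]
  have hap4 : ∀ w u t s : List Bool, w ++ (u ++ (t ++ (s ++ z))) ≠ [] := by simp [hz]
  have h := hsym i.a i.b i.c i.e (z ++ i.l) hi.1 hi.2.1 hi.2.2.1 hi.2.2.2 (by simp [hz])
  have h1 : ∀ w, ev L [(1, 0)] w = L w := by intro w; simp [ev, dec_zero]
  simp only [vRel, ev_add L h101, key, ne_eq, hz, not_false_eq_true, hap, hap2, hap3, hap4,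
    one_smul, h1]
  rw [← h]
  simp only [symSum, List.append_assoc, hc z]
  abel

theorem ev_zero {W : Type*} [AddCommGroup W] (L : List Bool → W) (h101 : ∀ w : W, 101 • w = 0)
    (v : Vc) (h : vZero v = true) (z : List Bool) : ev L v z = 0 := by
  induction v with
  | nil => rfl
  | cons p t ih =>
    rw [vZero, Bool.and_eq_true] at h
    rw [ev_cons, ih h.2, ← mod_smul h101, Nat.eq_of_beq_eq_true h.1]
    simp

theorem ev_comb {W : Type*} [AddCommGroup W] (L : List Bool → W) (h101 : ∀ w : W, 101 • w = 0)
    (R : List Vc) (z : List Bool) (hR : ∀ v ∈ R, ev L v z = 0) (l : List (ℕ × ℕ)) :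
    ev L (vComb R l) z = 0 := by
  induction l with
  | nil => rfl
  | cons p t ih =>
    rw [vComb, ev_add L h101, ih]
    have : ev L (R.getD p.2 []) z = 0 := by
      rw [List.getD_eq_getElem?_getD]
      cases h : R[p.2]? with
      | none => rfl
      | some b => exact hR b (List.mem_of_getElem? h)
    rw [this]; simp

theorem chk_rules {W : Type*} [AddCommGroup W] (L : List Bool → W) (h101 : ∀ w : W, 101 • w = 0)
    (R : List Vc) (z : List Bool) (hR : ∀ v ∈ R, ev L v z = 0) (l : List Crt)
    (h : chkRules R l = true) : ∀ r ∈ l, L (dec r.1 ++ z) = ev L r.2.1 z := by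
  induction l with
  | nil => simp
  | cons p t ih =>
    rw [chkRules, Bool.and_eq_true] at h
    intro r hr
    rcases List.mem_cons.1 hr with rfl | hr
    · have := ev_zero L h101 _ h.1 z
      rw [ev_add L h101, ev_add L h101, ev_comb L h101 R z hR, one_smul, add_zero, ev_cons,
        ev_nil, add_zero, one_smul] at this
      have h2 := h101 (L (dec r.1 ++ z))
      rw [show (101 : ℕ) = 1 + 100 from rfl, add_smul, one_smul] at h2
      exact (add_right_cancel (this.trans h2.symm)).symm
    · exact ih h.2 r hr

theorem sound_snoc {W : Type*} [AddCommGroup W] (L : List Bool → W) (h101 : ∀ w : W, 101 • w = 0)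
    (hc : ∀ u v, L (u ++ v) = L (v ++ u))
    (hsym : ∀ a b c e z, a ≠ [] → b ≠ [] → c ≠ [] → e ≠ [] → z ≠ [] → symSum L a b c e z = 0)
    (env : Env) (hs : Sound L env) (I : List Inst) (l : List Crt)
    (hI : I.all (fun i => !(i.a.isEmpty || i.b.isEmpty || i.c.isEmpty || i.e.isEmpty)) = true)
    (h : chkRules (I.map (vRel env)) l = true) : Sound L (env ++ [rulesOf l]) := by
  intro blk hb r hr z hz
  rcases List.mem_append.1 hb with hb | hb
  · exact hs blk hb r hr z hz
  · rw [List.mem_singleton] at hb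
    subst hb
    obtain ⟨q, hq, rfl⟩ := List.mem_map.1 hr
    refine chk_rules L h101 _ z ?_ l h q hq
    intro v hv
    obtain ⟨i, hi, rfl⟩ := List.mem_map.1 hv
    refine ev_rel L h101 hc hsym env hs i ?_ z hz
    have := List.all_eq_true.1 hI i hi
    simpa [and_assoc] using this

theorem ev_tApp {W : Type*} [AddCommGroup W] (L : List Bool → W) (h101 : ∀ w : W, 101 • w = 0)
    (env : Env) (hs : Sound L env) (w : List Bool) (v : Vc) :
    ev L (tApp env w v) [] = ev L v w := by
  induction w generalizing v with
  | nil => rfl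
  | cons b w ih =>
    cases w with
    | nil =>
      rw [tApp]
      induction v with
      | nil => rfl
      | cons p t ih2 =>
        rw [List.map_cons, ev_cons, ih2, ev_cons, dec_odd, List.append_nil]
    | cons b' w => rw [tApp, ih, ev_step L h101 env hs _ _ _ (by simp)]

theorem ev_rot {W : Type*} [AddCommGroup W] (L : List Bool → W) (h101 : ∀ w : W, 101 • w = 0)
    (hc : ∀ u v, L (u ++ v) = L (v ++ u))
    (env : Env) (hs : Sound L env) (r : Bool × List Bool) : ev L (rotRow env r) [] = 0 := by
  have h1 : ∀ w, ev L [(1, 0)] w = L w := by intro w; simp [ev, dec_zero]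
  rw [rotRow, ev_add L h101, ev_add L h101, ev_tApp L h101 env hs, ev_tApp L h101 env hs, h1, h1,
    hc r.2, ev_nil, add_zero, one_smul]
  have h2 := h101 (L (r.1 :: r.2))
  rw [show (101 : ℕ) = 1 + 100 from rfl, add_smul, one_smul] at h2
  exact h2

/-- check of the trace level -/
def chkTr (env : Env) (rots : List (Bool × List Bool)) (gw : List (List Bool))
    (l : List (ℕ × List (ℕ × ℕ))) : Bool :=
  chkRules (rots.map (rotRow env) ++ gw.map (fun w => tApp env w [(1, 0)]))
    (l.map fun p => (p.1, [], p.2))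

theorem chk_tr {W : Type*} [AddCommGroup W] (L : List Bool → W) (h101 : ∀ w : W, 101 • w = 0)
    (hc : ∀ u v, L (u ++ v) = L (v ++ u))
    (env : Env) (hs : Sound L env) (rots : List (Bool × List Bool)) (gw : List (List Bool))
    (l : List (ℕ × List (ℕ × ℕ))) (hg : ∀ w ∈ gw, L w = 0) (h : chkTr env rots gw l = true) :
    ∀ n ∈ l.map Prod.fst, L (dec n) = 0 := by
  intro n hn
  obtain ⟨p, hp, rfl⟩ := List.mem_map.1 hn
  have h1 : ∀ w, ev L [(1, 0)] w = L w := by intro w; simp [ev, dec_zero]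
  have := chk_rules L h101 _ [] ?_ _ h (p.1, [], p.2) (List.mem_map.2 ⟨p, hp, rfl⟩)
  · simpa [ev_nil] using this
  · intro v hv
    rcases List.mem_append.1 hv with hv | hv
    · obtain ⟨i, hi, rfl⟩ := List.mem_map.1 hv
      exact ev_rot L h101 hc env hs i
    · obtain ⟨i, hi, rfl⟩ := List.mem_map.1 hv
      rw [ev_tApp L h101 env hs, h1, hg i hi]

/-- closure of the bases under right multiplication -/
def chkB (env : Env) (B B' : List ℕ) : Bool :=
  B.all fun n => (vRed env (2 * n + 1)).all (fun p => B'.contains p.2) &&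
    (vRed env (2 * n + 2)).all (fun p => B'.contains p.2)

/-- normal forms exist in degree `k` -/
def Spans {W : Type*} [AddCommGroup W] (L : List Bool → W) (k : ℕ) (B : List ℕ) : Prop :=
  ∀ u : List Bool, u.length = k → ∃ v : Vc, (∀ p ∈ v, p.2 ∈ B) ∧
    ∀ z, z ≠ [] → L (u ++ z) = ev L v z

theorem vIns_mem (c n : ℕ) (v : Vc) (q : ℕ × ℕ) (h : q ∈ vIns c n v) :
    q.2 = n ∨ ∃ p ∈ v, q.2 = p.2 := by
  induction v with
  | nil => simp [vIns] at h; left; simp [h]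
  | cons p t ih =>
    rw [vIns] at h
    cases hb : Nat.beq n p.2
    · rw [hb, cond_false, List.mem_cons] at h
      rcases h with rfl | h
      · right; exact ⟨q, by simp, rfl⟩
      · rcases ih h with h | ⟨p', hp', h⟩
        · left; exact h
        · right; exact ⟨p', by simp [hp'], h⟩
    · rw [hb, cond_true, List.mem_cons] at h
      rcases h with rfl | h
      · left; rfl
      · right; exact ⟨q, by simp [h], rfl⟩

theorem vAdd_mem (c : ℕ) (v w : Vc) (q : ℕ × ℕ) (h : q ∈ vAdd c v w) :
    (∃ p ∈ v, q.2 = p.2) ∨ ∃ p ∈ w, q.2 = p.2 := by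
  induction v generalizing q with
  | nil => right; exact ⟨q, h, rfl⟩
  | cons p t ih =>
    rw [vAdd] at h
    rcases vIns_mem _ _ _ _ h with h | ⟨p', hp', h⟩
    · left; exact ⟨p, by simp, h⟩
    · rcases ih p' hp' with ⟨r, hr, h2⟩ | ⟨r, hr, h2⟩
      · left; exact ⟨r, by simp [hr], h.trans h2⟩
      · right; exact ⟨r, hr, h.trans h2⟩

theorem spans_succ {W : Type*} [AddCommGroup W] (L : List Bool → W) (h101 : ∀ w : W, 101 • w = 0)
    (env : Env) (hs : Sound L env) (k : ℕ) (B B' : List ℕ) (hB : Spans L k B)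
    (h : chkB env B B' = true) : Spans L (k + 1) B' := by
  intro u hu
  have hne : u ≠ [] := by intro h; simp [h] at hu
  obtain ⟨v, hv, hv2⟩ := hB u.dropLast (by simp [hu])
  refine ⟨vStep env (u.getLast hne) v, ?_, ?_⟩
  · clear hv2
    generalize u.getLast hne = b
    induction v with
    | nil => simp [vStep]
    | cons p t ih =>
      intro q hq
      rw [vStep] at hq
      rcases vAdd_mem _ _ _ _ hq with ⟨r, hr, h2⟩ | ⟨r, hr, h2⟩
      · rw [h2]
        have := List.all_eq_true.1 h p.2 (hv p (by simp))
        rw [Bool.and_eq_true] at this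
        cases b
        · simpa using List.all_eq_true.1 this.1 r hr
        · simpa using List.all_eq_true.1 this.2 r hr
      · rw [h2]
        exact ih (fun p hp => hv p (by simp [hp])) r hr
  · intro z hz
    rw [ev_step L h101 env hs _ _ _ hz, ← hv2 _ (by simp)]
    conv_lhs => rw [← List.dropLast_append_getLast hne]
    simp

theorem zero_of_spans {W : Type*} [AddCommGroup W] (L : List Bool → W) (k : ℕ) (B : List ℕ)
    (hB : Spans L k B) (C : List ℕ) (hC : ∀ n ∈ C, L (dec n) = 0)
    (h : (B.all fun n => C.contains (2 * n + 1) && C.contains (2 * n + 2)) = true)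
    (w : List Bool) (hw : w.length = k + 1) : L w = 0 := by
  have hne : w ≠ [] := by intro h; simp [h] at hw
  obtain ⟨v, hv, hv2⟩ := hB w.dropLast (by simp [hw])
  have := hv2 [w.getLast hne] (by simp)
  rw [List.dropLast_append_getLast hne] at this
  rw [this]
  generalize w.getLast hne = b
  clear this hv2
  induction v with
  | nil => rfl
  | cons p t ih =>
    rw [ev_cons, ih (fun p hp => hv p (by simp [hp])), ← dec_odd]
    have := List.all_eq_true.1 h p.2 (hv p (by simp))
    rw [Bool.and_eq_true] at this
    have h0 : L (dec (2 * p.2 + 1 + b.toNat)) = 0 := by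
      apply hC
      cases b
      · simpa using this.1
      · simpa using this.2
    rw [h0]; simp

theorem spans_zero {W : Type*} [AddCommGroup W] (L : List Bool → W) : Spans L 0 [0] := by
  intro u hu
  refine ⟨[(1, 0)], by simp, fun z _ => ?_⟩
  rw [List.length_eq_zero_iff.1 hu]
  simp [ev, dec_zero]

def wcA : ℕ → ℕ → List Bool → List Bool
  | 0, _, acc => acc
  | k + 1, n, acc => bif Nat.ble n 1 then acc else wcA k (n / 2) (Nat.beq (n % 2) 1 :: acc)

/-- word from its code -/
def wc (n : ℕ) : List Bool := wcA 12 n []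

def mkI (l a b c e : ℕ) : Inst := ⟨wc l, wc a, wc b, wc c, wc e⟩

def inst4 : List Inst := [
    mkI 1 2 2 2 2, mkI 1 2 2 2 3, mkI 1 2 2 3 3, mkI 1 2 3 3 3, mkI 1 3 3 3 3]
def crt4 : List Crt := [
    (15, [], [(80, 0)]), (23, [(100, 16), (100, 17), (100, 19)], [(17, 1)]),
    (27, [(100, 18), (100, 20), (100, 21), (100, 24), (100, 25)], [(76, 2)]),
    (29, [(100, 22), (100, 26), (100, 28)], [(17, 3)]), (30, [], [(80, 4)])]
def inst5 : List Inst := [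
    mkI 2 2 2 2 3, mkI 2 2 2 3 3, mkI 2 2 3 3 3, mkI 2 3 3 3 3, mkI 1 2 2 2 7, mkI 1 2 2 3 7]
def crt5 : List Crt := [
    (39, [(100, 33), (100, 35)], [(17, 0)]),
    (43, [(100, 34), (100, 36), (100, 37), (100, 40), (100, 41)], [(76, 1)]),
    (45, [(100, 38), (100, 42), (100, 44)], [(17, 2)]), (46, [], [(80, 3)]),
    (51, [(1, 34), (100, 41), (100, 49)], [(84, 4)]),
    (57, [(1, 38), (100, 53), (100, 52)], [(50, 5)])]
def inst6 : List Inst := [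
    mkI 4 2 2 2 3, mkI 4 2 2 3 3, mkI 4 2 3 3 3, mkI 4 3 3 3 3, mkI 6 2 2 2 3, mkI 6 2 2 3 3,
    mkI 6 2 3 3 3, mkI 6 3 3 3 3, mkI 2 2 2 3 7, mkI 1 2 2 2 13, mkI 1 2 2 2 15, mkI 1 2 2 3 15]
def crt6 : List Crt := [
    (71, [(100, 67)], [(17, 0)]), (75, [(100, 68), (100, 69), (100, 72), (100, 73)], [(76, 1)]),
    (77, [(100, 70), (100, 74), (100, 76)], [(17, 2)]), (78, [], [(80, 3)]),
    (83, [(100, 73), (100, 81)], [(84, 4)]), (89, [(1, 70), (100, 85), (100, 84)], [(50, 8)]),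
    (99, [(1, 68), (1, 73), (1, 69)], [(84, 9)]), (105, [(100, 70)], [(17, 10)]),
    (107, [(1, 74), (1, 82), (100, 101), (1, 84), (1, 70)], [(76, 5), (84, 10)]),
    (109, [(100, 102), (100, 106), (100, 108)], [(17, 6)]), (110, [], [(80, 7)]),
    (117, [(1, 86), (1, 102), (1, 106)], [(80, 3), (50, 11)])]
def inst7 : List Inst := [
    mkI 8 2 2 2 3, mkI 8 2 2 3 3, mkI 8 2 3 3 3, mkI 8 3 3 3 3, mkI 10 2 2 2 3, mkI 10 2 2 3 3,
    mkI 10 2 3 3 3, mkI 10 3 3 3 3, mkI 12 2 2 2 3, mkI 12 2 2 3 3, mkI 12 2 3 3 3,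
    mkI 12 3 3 3 3, mkI 14 2 2 2 3, mkI 14 2 2 3 3, mkI 14 2 3 3 3, mkI 14 3 3 3 3,
    mkI 4 2 2 3 7, mkI 6 2 2 3 7, mkI 1 2 2 2 27, mkI 1 2 2 3 27]
def crt7 : List Crt := [
    (135, [], [(17, 0)]), (139, [(100, 136), (100, 137)], [(76, 1)]),
    (141, [(100, 138), (100, 140)], [(17, 2)]), (142, [], [(80, 3)]),
    (147, [(100, 137), (100, 145)], [(84, 4)]), (153, [(100, 149), (100, 148)], [(50, 16)]),
    (163, [(1, 137)], [(84, 8)]), (169, [], [(17, 12)]),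
    (171, [(1, 138), (1, 146), (100, 165), (1, 148)], [(76, 5), (84, 12)]),
    (173, [(100, 166), (100, 170), (100, 172)], [(17, 6)]), (174, [], [(80, 7)]),
    (181, [(1, 150), (1, 166), (1, 170)], [(25, 13), (51, 17)]),
    (201, [(98, 138), (100, 149), (100, 146), (1, 165), (100, 148), (1, 164)], [(25, 5), (76, 9), (17, 18)]),
    (203, [(1, 138), (100, 140), (2, 149), (1, 146), (1, 148)], [(17, 2), (76, 5), (84, 18)]),
    (205, [(1, 150), (1, 166), (100, 202), (100, 204)], [(80, 3), (17, 10)]),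
    (206, [], [(80, 11)]),
    (213, [(100, 154), (98, 150), (100, 170), (1, 172), (100, 202), (1, 204)], [(21, 3), (67, 6), (76, 13), (50, 17), (51, 19)]),
    (217, [(1, 170), (2, 150), (100, 166), (1, 154), (100, 172), (1, 202), (100, 204)], [(80, 3), (34, 6), (25, 13), (50, 19)]),
    (237, [(1, 182), (1, 214), (1, 218)], [(17, 14)]), (238, [], [(80, 15)])]
def inst8 : List Inst := [
    mkI 18 2 2 2 3, mkI 18 2 2 3 3, mkI 18 2 3 3 3, mkI 18 3 3 3 3, mkI 20 2 2 2 3,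
    mkI 20 2 2 3 3, mkI 20 2 3 3 3, mkI 20 3 3 3 3, mkI 22 2 2 2 3, mkI 22 2 2 3 3,
    mkI 22 2 3 3 3, mkI 22 3 3 3 3, mkI 26 2 2 2 3, mkI 26 2 2 3 3, mkI 26 2 3 3 3,
    mkI 26 3 3 3 3, mkI 8 2 2 3 7, mkI 10 2 2 3 7, mkI 12 2 2 3 7, mkI 14 2 2 3 7,
    mkI 2 2 2 3 27, mkI 1 2 2 2 51, mkI 1 2 2 2 55, mkI 1 2 2 2 59, mkI 1 2 2 3 55]
def crt8 : List Crt := [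
    (275, [(100, 273)], [(84, 0)]),
    (277, [(100, 274), (100, 276)], [(44, 1), (80, 8), (80, 12), (63, 16), (80, 21)]),
    (278, [], [(21, 2), (80, 6), (63, 17), (38, 18), (80, 22)]),
    (281, [(1, 274)], [(57, 1), (21, 8), (21, 12), (88, 16), (21, 21)]), (291, [], [(84, 4)]),
    (297, [], [(17, 8)]), (299, [(1, 274), (100, 293), (1, 276)], [(76, 1), (84, 8)]),
    (301, [(100, 294), (100, 298), (100, 300)], [(17, 2)]), (302, [], [(80, 3)]),
    (309, [(1, 294), (1, 298)], [(21, 2), (80, 6), (25, 9), (13, 17), (38, 18), (80, 22)]),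
    (329, [(1, 293), (1, 292)], [(82, 1), (76, 5), (21, 8), (38, 12), (38, 16), (21, 21)]),
    (331, [(100, 274), (100, 276)], [(63, 1), (59, 8), (42, 12), (25, 16), (59, 21)]),
    (332, [(2, 298), (1, 300), (1, 330)], [(82, 9), (63, 13), (50, 17), (38, 18), (88, 20), (38, 22), (38, 23)]),
    (333, [(1, 294), (99, 330), (99, 298), (100, 300)], [(21, 2), (97, 6), (19, 9), (38, 13), (13, 17), (13, 20), (42, 22), (63, 23)]),
    (334, [], [(80, 7)]),
    (341, [(100, 282), (1, 298), (2, 300)], [(4, 2), (63, 6), (57, 9), (63, 13), (12, 17), (25, 18), (38, 20), (38, 23)]),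
    (345, [(100, 298), (100, 294), (1, 282), (99, 300)], [(76, 2), (59, 6), (44, 9), (38, 13), (76, 17), (38, 18), (63, 20), (21, 22), (63, 23)]),
    (365, [(1, 310), (1, 342), (1, 346)], [(17, 10)]), (366, [], [(80, 11)]),
    (405, [(100, 298), (100, 330), (100, 300), (1, 294), (1, 282)], [(17, 6), (82, 9), (38, 13), (51, 17), (38, 18), (38, 20), (21, 22), (4, 23)]),
    (406, [(100, 310), (100, 342)], [(21, 3), (20, 7), (42, 10), (21, 14), (38, 24)]),
    (409, [(1, 300), (100, 330), (100, 282)], [(63, 2), (21, 6), (38, 9), (88, 17), (88, 18), (76, 20), (80, 22), (59, 23)]),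
    (429, [(100, 310), (100, 346), (100, 410)], [(80, 3), (40, 7), (84, 10), (59, 14), (76, 24)]),
    (430, [], [(80, 15)]), (437, [(100, 342)], [(51, 19)])]
def inst9 : List Inst := [
    mkI 36 2 2 2 3, mkI 36 2 2 3 3, mkI 36 2 3 3 3, mkI 36 3 3 3 3, mkI 38 2 2 2 3,
    mkI 38 2 2 3 3, mkI 38 2 3 3 3, mkI 38 3 3 3 3, mkI 42 2 2 2 3, mkI 42 2 2 3 3,
    mkI 42 2 3 3 3, mkI 42 3 3 3 3, mkI 54 2 2 2 3, mkI 54 2 2 3 3, mkI 54 2 3 3 3,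
    mkI 54 3 3 3 3, mkI 18 2 2 3 7, mkI 22 2 2 3 7, mkI 4 2 2 3 27, mkI 6 2 2 3 27,
    mkI 1 2 2 2 101, mkI 1 2 2 2 103, mkI 1 2 2 2 119, mkI 1 2 2 3 119]
def crt9 : List Crt := [
    (547, [], [(84, 0)]), (549, [(100, 548)], [(44, 1), (21, 4), (21, 8), (80, 20)]),
    (550, [], [(80, 12), (88, 16), (80, 21)]), (553, [], [(17, 4)]),
    (565, [(1, 554)], [(25, 5), (80, 12), (38, 16), (80, 21)]),
    (566, [], [(91, 3), (42, 6), (21, 10), (41, 13), (44, 17), (80, 22)]),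
    (585, [], [(19, 1), (21, 4), (38, 8), (80, 20)]), (587, [], [(84, 8)]),
    (588, [(1, 554), (1, 586)], [(21, 2), (82, 5), (63, 9), (42, 12), (88, 18), (21, 21)]),
    (589, [(99, 586), (100, 554)], [(97, 2), (19, 5), (38, 9), (38, 12), (88, 16), (13, 18), (59, 21)]),
    (590, [], [(80, 3)]),
    (597, [(100, 554)], [(21, 2), (57, 5), (63, 9), (63, 12), (63, 16), (38, 18), (42, 21)]),
    (601, [(1, 554)], [(80, 2), (44, 5), (38, 9), (59, 12), (63, 18), (80, 21)]),
    (621, [(1, 598), (1, 602)], [(91, 3), (59, 6), (21, 10), (41, 13), (44, 17), (80, 22)]),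
    (622, [], [(80, 7)]),
    (661, [(100, 586)], [(38, 2), (82, 5), (38, 9), (97, 12), (63, 16), (38, 18), (59, 21)]),
    (662, [(100, 598)], [(20, 3), (21, 10), (38, 17), (63, 19), (21, 22)]),
    (685, [(100, 598), (99, 602)], [(10, 3), (42, 6), (59, 10), (41, 13), (82, 17), (63, 19)]),
    (686, [], [(80, 11)]), (693, [(100, 598)], [(51, 17)]),
    (821, [], [(81, 3), (21, 10), (63, 13), (63, 17), (63, 19), (21, 22)]),
    (822, [(100, 694)], [(81, 7), (81, 11), (42, 14), (38, 23)]),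
    (877, [(100, 694)], [(61, 7), (61, 11), (76, 23)]), (878, [], [(80, 15)])]
def inst10 : List Inst := [
    mkI 74 2 2 2 3, mkI 74 2 2 3 3, mkI 74 2 3 3 3, mkI 74 3 3 3 3, mkI 86 2 2 2 3,
    mkI 86 2 2 3 3, mkI 86 2 3 3 3, mkI 86 3 3 3 3, mkI 8 2 2 3 27, mkI 10 2 2 3 27,
    mkI 14 2 2 3 27, mkI 1 2 2 2 215]
def crt10 : List Crt := [
    (1097, [], [(17, 0)]), (1098, [], [(19, 1), (40, 4), (57, 8)]),
    (1109, [], [(63, 1), (21, 4), (38, 8)]), (1110, [], [(42, 2), (82, 5), (80, 11)]),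
    (1173, [], [(19, 1), (99, 4), (82, 8)]), (1174, [], [(94, 2), (80, 5), (63, 9), (21, 11)]),
    (1197, [], [(94, 2), (42, 5), (63, 9), (80, 11)]), (1198, [], [(80, 3)]),
    (1205, [], [(14, 2), (61, 5), (21, 11)]), (1206, [], [(51, 3), (21, 6), (19, 10)]),
    (1389, [], [(10, 3), (80, 6), (57, 10)]), (1390, [], [(80, 7)])]
def bas0 : List ℕ := [
    0]
def bas1 : List ℕ := [
    1, 2]
def bas2 : List ℕ := [
    3, 4, 5, 6]
def bas3 : List ℕ := [
    7, 8, 9, 10, 11, 12, 13, 14]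
def bas4 : List ℕ := [
    16, 17, 18, 19, 20, 21, 22, 24, 25, 26, 28]
def bas5 : List ℕ := [
    33, 34, 35, 36, 37, 38, 40, 41, 42, 44, 49, 50, 52, 53, 54, 58]
def bas6 : List ℕ := [
    67, 68, 69, 70, 72, 73, 74, 76, 81, 82, 84, 85, 86, 90, 100, 101, 102, 106, 108, 118]
def bas7 : List ℕ := [
    136, 137, 138, 140, 145, 146, 148, 149, 150, 154, 164, 165, 166, 170, 172, 182, 202, 204,
    214, 218]
def bas8 : List ℕ := [
    273, 274, 276, 282, 292, 293, 294, 298, 300, 310, 330, 342, 346, 410, 438]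
def bas9 : List ℕ := [
    548, 554, 586, 598, 602, 694]
def bas10 : List ℕ := [
    ]
def rot1 : List (Bool × List Bool) := [
    ]
def tc1 : List (ℕ × List (ℕ × ℕ)) := [
    (1, [(1, 0)]), (2, [(1, 1)])]
def rot2 : List (Bool × List Bool) := [
    (false, wc 3)]
def tc2 : List (ℕ × List (ℕ × ℕ)) := [
    (3, [(1, 1)]), (4, [(1, 2)]), (5, [(100, 0), (1, 2)]), (6, [(1, 3)])]
def rot3 : List (Bool × List Bool) := [
    (false, wc 5), (true, wc 4), (true, wc 5), (false, wc 7)]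
def tc3 : List (ℕ × List (ℕ × ℕ)) := [
    (7, [(1, 4)]), (8, [(1, 5)]), (9, [(100, 0), (1, 5)]), (10, [(1, 6)]),
    (11, [(1, 1), (1, 5)]), (12, [(1, 2), (1, 6)]), (13, [(100, 3), (1, 6)]), (14, [(1, 7)])]
def rot4 : List (Bool × List Bool) := [
    (false, wc 9), (true, wc 8), (true, wc 9), (false, wc 10), (false, wc 11), (true, wc 10),
    (true, wc 11), (true, wc 12), (true, wc 13), (false, wc 15)]
def tc4 : List (ℕ × List (ℕ × ℕ)) := [
    (15, [(1, 10)]), (16, [(1, 11)]), (17, [(100, 0), (1, 11)]), (18, [(1, 12)]),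
    (19, [(100, 0), (100, 3), (1, 11)]), (20, [(1, 15)]), (21, [(100, 4), (1, 12)]),
    (22, [(1, 13)]), (23, [(1, 1), (1, 11)]), (24, [(1, 2), (1, 12)]), (25, [(1, 5), (1, 15)]),
    (26, [(1, 6), (1, 13)]), (27, [(1, 2), (1, 7), (1, 12)]), (28, [(1, 6), (1, 8), (1, 13)]),
    (29, [(100, 9), (1, 13)]), (30, [(1, 14)])]
def rot5 : List (Bool × List Bool) := [
    (false, wc 17), (true, wc 16), (true, wc 17), (false, wc 18), (false, wc 19), (true, wc 18),
    (true, wc 19), (false, wc 21), (true, wc 20), (true, wc 21), (false, wc 22), (false, wc 23),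
    (true, wc 22), (true, wc 23), (false, wc 25), (true, wc 25), (false, wc 27), (true, wc 26),
    (true, wc 27), (true, wc 29)]
def tc5 : List (ℕ × List (ℕ × ℕ)) := [
    (33, [(100, 0)]), (34, [(1, 20)]), (35, [(100, 0), (100, 3)]),
    (36, [(50, 2), (50, 5), (50, 14), (100, 20)]), (37, [(100, 4), (1, 20)]),
    (38, [(66, 6), (34, 9), (100, 11), (68, 12), (33, 15), (67, 16), (1, 17), (1, 21)]),
    (39, [(2, 0), (100, 1), (1, 3)]), (40, [(50, 2), (51, 5), (51, 14), (100, 20)]),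
    (41, [(50, 2), (50, 5), (100, 7), (50, 14), (100, 20)]),
    (42, [(68, 6), (33, 9), (1, 11), (67, 12), (34, 15), (68, 16), (100, 17), (100, 21)]),
    (43, [(100, 4), (100, 10), (1, 20)]),
    (44, [(68, 6), (33, 9), (1, 11), (66, 12), (34, 15), (67, 16), (100, 17), (100, 21)]),
    (45, [(66, 6), (34, 9), (99, 11), (68, 12), (33, 15), (67, 16), (1, 17), (1, 21)]),
    (46, [(75, 13), (50, 18), (25, 19)]), (49, [(50, 2), (51, 5), (50, 14), (100, 20)]),
    (50, [(67, 6), (34, 9), (100, 11), (68, 12), (33, 15), (67, 16), (1, 17), (1, 21)]),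
    (51, [(50, 2), (51, 5), (1, 8), (51, 14), (100, 20)]),
    (52, [(68, 6), (34, 9), (1, 11), (67, 12), (34, 15), (68, 16), (100, 17), (100, 21)]),
    (53, [(68, 6), (33, 9), (1, 11), (67, 12), (34, 15), (67, 16), (100, 17), (100, 21)]),
    (54, [(76, 13), (50, 18), (25, 19)]),
    (57, [(68, 6), (34, 9), (1, 11), (67, 12), (34, 15), (68, 16), (100, 21)]),
    (58, [(76, 13), (51, 18), (25, 19)])]
def rot6 : List (Bool × List Bool) := [
    (false, wc 34), (false, wc 35), (true, wc 34), (true, wc 35), (false, wc 36), (false, wc 37),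
    (true, wc 36), (true, wc 37), (false, wc 38), (false, wc 39), (true, wc 38), (true, wc 39),
    (false, wc 41), (true, wc 40), (true, wc 41), (false, wc 43), (true, wc 42), (true, wc 43),
    (false, wc 45), (true, wc 44), (true, wc 45), (false, wc 46), (false, wc 47), (true, wc 46),
    (true, wc 47), (true, wc 51), (true, wc 54), (true, wc 55)]
def tc6 : List (ℕ × List (ℕ × ℕ)) := [
    (67, [(100, 0)]), (68, [(51, 1), (50, 2), (51, 5), (51, 12), (50, 28)]), (69, [(100, 1)]),
    (70, [(50, 3), (51, 7), (50, 9), (50, 10), (51, 14), (50, 16), (50, 21), (50, 30), (50, 31)]),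
    (71, [(100, 0), (100, 4)]), (72, [(1, 28)]),
    (73, [(51, 1), (50, 2), (50, 5), (51, 12), (50, 28)]),
    (74, [(1, 3), (100, 7), (3, 9), (1, 10), (100, 14), (1, 15), (1, 16), (1, 18), (2, 21), (1, 31)]),
    (75, [(100, 1), (100, 8)]), (76, [(1, 30)]),
    (77, [(50, 3), (51, 7), (49, 9), (50, 10), (51, 14), (50, 16), (50, 21), (50, 30), (50, 31)]),
    (78, [(1, 22)]), (81, [(100, 12), (1, 28)]),
    (82, [(100, 3), (99, 9), (100, 15), (100, 18), (100, 21), (1, 30)]),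
    (83, [(50, 1), (50, 2), (51, 5), (100, 6), (51, 12), (100, 13), (50, 28)]),
    (84, [(50, 3), (51, 7), (49, 9), (49, 10), (51, 14), (49, 16), (49, 21), (49, 30), (49, 31)]),
    (85, [(1, 3), (100, 7), (3, 9), (1, 10), (100, 14), (1, 16), (1, 18), (2, 21), (1, 31)]),
    (86, [(100, 11), (50, 17), (51, 20), (49, 22), (50, 25), (51, 26), (50, 29)]),
    (89, [(100, 18), (1, 30)]), (90, [(100, 20), (100, 26), (1, 29)]), (99, [(1, 6), (1, 28)]),
    (100, [(1, 3), (3, 9), (1, 10), (100, 14), (1, 15), (1, 16), (1, 18), (2, 21), (1, 31)]),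
    (101, [(1, 10), (1, 30)]), (102, [(1, 11), (1, 22)]),
    (105, [(50, 3), (51, 7), (49, 9), (49, 10), (51, 14), (50, 16), (49, 21), (49, 30), (49, 31)]),
    (106, [(100, 11), (51, 17), (51, 20), (49, 22), (50, 25), (51, 26), (50, 29)]),
    (107, [(1, 3), (1, 9), (1, 10), (1, 16), (1, 19), (1, 21), (1, 31)]),
    (108, [(100, 26), (1, 29)]),
    (109, [(1, 11), (51, 17), (51, 20), (51, 22), (1, 23), (51, 25), (51, 26), (50, 29)]),
    (110, [(1, 24)]), (117, [(1, 29)]), (118, [(1, 24), (1, 27)])]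
def rot7 : List (Bool × List Bool) := [
    (false, wc 68), (false, wc 69), (true, wc 68), (true, wc 69), (false, wc 70), (false, wc 71),
    (true, wc 70), (true, wc 71), (false, wc 73), (true, wc 72), (true, wc 73), (false, wc 74),
    (false, wc 75), (true, wc 74), (true, wc 75), (false, wc 77), (true, wc 76), (true, wc 77),
    (false, wc 78), (false, wc 79), (true, wc 78), (true, wc 79), (false, wc 83), (true, wc 82),
    (true, wc 83), (false, wc 86), (false, wc 87), (true, wc 86), (true, wc 87), (false, wc 91),
    (true, wc 90), (true, wc 91), (false, wc 103), (true, wc 102), (true, wc 103),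
    (true, wc 109), (true, wc 110), (true, wc 111)]
def tc7 : List (ℕ × List (ℕ × ℕ)) := [
    (135, [(100, 0)]), (136, [(2, 1), (1, 4), (1, 9), (1, 11)]), (137, [(100, 1)]),
    (138, [(2, 5), (1, 12), (1, 15), (1, 18), (100, 38)]), (139, [(100, 4)]), (140, [(1, 38)]),
    (141, [(100, 5)]), (142, [(1, 19)]), (145, [(2, 1), (1, 4), (100, 8), (1, 9), (1, 11)]),
    (146, [(100, 5), (100, 6), (100, 15), (100, 18), (1, 22)]), (147, [(100, 1), (100, 11)]),
    (148, [(98, 5), (100, 6), (1, 10), (100, 12), (99, 15), (99, 18), (1, 22)]),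
    (149, [(2, 5), (1, 15), (1, 18), (100, 38)]),
    (150, [(1, 17), (100, 19), (1, 20), (1, 33), (1, 39)]), (153, [(100, 15), (1, 38)]),
    (154, [(1, 7), (1, 19), (1, 20), (1, 32)]), (163, [(100, 1), (100, 2), (100, 9)]),
    (164, [(100, 3), (1, 5), (1, 6), (100, 10), (1, 15), (1, 18), (100, 22)]),
    (165, [(100, 5), (100, 6), (100, 15), (100, 18)]),
    (166, [(100, 7), (100, 17), (100, 19), (100, 20), (100, 33), (100, 39)]),
    (169, [(1, 3), (1, 5), (1, 12), (100, 13), (1, 15), (1, 18), (100, 23)]),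
    (170, [(1, 7), (100, 14), (3, 19), (100, 24)]),
    (171, [(2, 5), (1, 15), (1, 18), (100, 25), (100, 38)]),
    (172, [(100, 7), (100, 17), (99, 20), (1, 26), (100, 27), (1, 29), (100, 32), (100, 33)]),
    (173, [(1, 17), (100, 19), (1, 20), (100, 26), (1, 33), (1, 39)]),
    (174, [(75, 21), (50, 28), (76, 31), (25, 34), (76, 35)]),
    (181, [(1, 7), (1, 19), (1, 20), (100, 29), (1, 32)]),
    (182, [(50, 21), (50, 31), (50, 34), (50, 35)]),
    (201, [(98, 5), (100, 6), (1, 10), (100, 12), (1, 13), (99, 15), (99, 18), (1, 22)]),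
    (202, [(1, 14), (1, 17), (100, 19), (1, 20), (1, 33), (1, 39)]),
    (203, [(2, 5), (2, 6), (100, 10), (2, 15), (1, 16), (2, 18), (99, 22)]),
    (204, [(1, 7), (1, 17), (1, 19), (1, 20), (1, 32)]),
    (205, [(100, 7), (100, 17), (100, 19), (100, 20), (100, 32), (100, 33), (100, 39)]),
    (206, [(1, 21)]),
    (213, [(100, 7), (100, 17), (99, 20), (1, 26), (1, 29), (100, 32), (100, 33)]),
    (214, [(75, 21), (51, 28), (76, 31), (25, 34), (76, 35)]),
    (217, [(1, 14), (1, 17), (99, 19), (2, 20), (1, 24), (100, 26), (1, 27), (100, 29), (1, 30), (1, 32), (1, 33)]),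
    (218, [(50, 21), (51, 31), (50, 34), (50, 35)]),
    (237, [(76, 21), (50, 28), (75, 31), (26, 34), (76, 35), (1, 36)]), (238, [(1, 37)])]
def rot8 : List (Bool × List Bool) := [
    (false, wc 137), (true, wc 136), (true, wc 137), (false, wc 138), (false, wc 139),
    (true, wc 138), (true, wc 139), (false, wc 141), (true, wc 140), (true, wc 141),
    (true, wc 142), (true, wc 143), (false, wc 147), (true, wc 146), (true, wc 147),
    (false, wc 149), (true, wc 148), (true, wc 149), (false, wc 151), (true, wc 150),
    (true, wc 151), (false, wc 155), (true, wc 154), (true, wc 155), (false, wc 167),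
    (true, wc 166), (true, wc 167), (false, wc 173), (true, wc 173), (true, wc 174),
    (true, wc 175), (false, wc 183), (true, wc 182), (true, wc 183), (true, wc 206),
    (true, wc 207)]
def tc8 : List (ℕ × List (ℕ × ℕ)) := [
    (273, [(100, 0)]), (274, [(50, 2), (50, 4), (50, 7), (50, 13), (50, 15), (100, 36)]),
    (275, [(100, 3)]), (276, [(51, 2), (51, 4), (51, 7), (51, 13), (51, 15)]), (277, [(100, 4)]),
    (278, [(1, 9), (100, 19), (100, 25), (1, 39)]), (281, [(100, 7)]),
    (282, [(100, 9), (1, 19), (1, 25), (100, 38), (100, 39)]), (291, [(1, 0), (1, 1), (1, 3)]),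
    (292, [(51, 2), (50, 4), (50, 7), (50, 13), (50, 15)]),
    (293, [(50, 2), (50, 4), (50, 7), (100, 12), (50, 13), (50, 15), (100, 36)]),
    (294, [(100, 9), (100, 10), (1, 18), (1, 19), (1, 24), (1, 25), (100, 38), (100, 39)]),
    (297, [(51, 2), (51, 4), (51, 7), (51, 13), (50, 15)]),
    (298, [(100, 9), (100, 10), (1, 14), (1, 18), (1, 19), (1, 24), (1, 25), (100, 39)]),
    (299, [(51, 4), (50, 5), (50, 7), (50, 8), (51, 12), (50, 13), (51, 15), (50, 16)]),
    (300, [(50, 6), (51, 9), (2, 10), (49, 14), (50, 17), (99, 18), (100, 19), (99, 24), (100, 25), (1, 38), (1, 39)]),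
    (301, [(1, 9), (100, 18), (100, 19), (100, 25), (1, 39)]),
    (302, [(25, 11), (76, 23), (76, 26), (25, 28)]),
    (309, [(100, 9), (1, 19), (100, 21), (1, 25), (100, 38), (100, 39)]),
    (310, [(75, 11), (100, 20), (24, 23), (25, 26), (76, 28), (1, 34), (1, 37)]),
    (329, [(100, 2), (100, 4), (100, 5), (100, 13)]),
    (330, [(100, 6), (1, 9), (1, 10), (100, 14), (100, 18), (100, 19), (100, 24), (100, 25), (1, 38), (1, 39)]),
    (331, [(49, 4), (51, 5), (50, 7), (50, 8), (50, 12), (51, 13), (50, 15), (51, 16), (100, 36)]),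
    (332, [(51, 6), (50, 9), (99, 10), (52, 14), (51, 17), (2, 18), (2, 24), (100, 38)]),
    (333, [(100, 9), (100, 10), (1, 18), (1, 19), (1, 25), (100, 38), (100, 39)]),
    (334, [(75, 11), (25, 23), (25, 26), (76, 28)]), (341, [(100, 39)]),
    (342, [(1, 11), (100, 20), (100, 26)]),
    (345, [(50, 6), (51, 9), (2, 10), (49, 14), (50, 17), (99, 18), (100, 19), (99, 24), (100, 25), (100, 27), (1, 38), (1, 39)]),
    (346, [(100, 11), (100, 23), (1, 26), (1, 29), (100, 31), (1, 34)]),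
    (365, [(75, 11), (100, 20), (24, 23), (25, 26), (76, 28), (100, 31), (1, 34), (1, 37)]),
    (366, [(100, 30), (100, 35)]),
    (405, [(50, 6), (51, 9), (2, 10), (49, 14), (50, 17), (99, 18), (99, 24), (100, 25), (1, 38), (1, 39)]),
    (406, [(25, 11), (1, 20), (76, 23), (76, 26), (25, 28)]),
    (409, [(51, 6), (51, 9), (100, 10), (51, 14), (51, 17), (1, 18), (1, 22), (1, 24), (100, 38)]),
    (410, [(75, 11), (100, 20), (25, 23), (25, 26), (76, 28), (1, 34), (1, 37)]),
    (429, [(26, 11), (1, 20), (77, 23), (76, 26), (25, 28), (1, 31), (100, 34)]),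
    (430, [(1, 30)]), (437, [(100, 20), (100, 26), (1, 32)]),
    (438, [(100, 30), (1, 33), (100, 35)])]
def rot9 : List (Bool × List Bool) := [
    (false, wc 274), (false, wc 275), (true, wc 274), (true, wc 275), (false, wc 277),
    (true, wc 276), (true, wc 277), (true, wc 278), (true, wc 279), (false, wc 283),
    (true, wc 282), (true, wc 283), (false, wc 295), (true, wc 294), (true, wc 295),
    (false, wc 299), (true, wc 299), (true, wc 302), (true, wc 303), (false, wc 311),
    (true, wc 310), (true, wc 311), (true, wc 335), (false, wc 347), (true, wc 366),
    (true, wc 367)]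
def tc9 : List (ℕ × List (ℕ × ℕ)) := [
    (547, [(100, 0)]), (548, [(1, 26)]), (549, [(100, 1)]),
    (550, [(100, 9), (100, 13), (100, 15), (100, 27)]), (553, [(100, 4)]),
    (554, [(100, 3), (100, 6), (2, 9), (2, 13), (2, 15), (1, 27)]), (565, [(100, 9)]),
    (566, [(16, 8), (51, 11), (17, 14), (84, 16), (1, 17), (1, 20), (1, 28)]),
    (585, [(1, 1), (1, 2), (1, 4), (1, 26)]),
    (586, [(2, 3), (1, 6), (99, 9), (99, 13), (99, 15), (100, 27)]),
    (587, [(100, 2), (100, 4), (100, 5)]),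
    (588, [(100, 3), (100, 6), (1, 9), (1, 13), (1, 15), (1, 27)]),
    (589, [(100, 9), (100, 12), (100, 13), (100, 15), (100, 27)]),
    (590, [(33, 8), (33, 14), (67, 16)]),
    (597, [(100, 3), (100, 6), (2, 9), (2, 13), (1, 15), (1, 27)]),
    (598, [(17, 8), (50, 11), (17, 14), (84, 16), (100, 17), (100, 20), (100, 28)]),
    (601, [(1, 3), (1, 6), (51, 7), (99, 9), (50, 10), (100, 13), (50, 15)]),
    (602, [(1, 17), (1, 20), (1, 28)]),
    (621, [(16, 8), (51, 11), (17, 14), (84, 16), (1, 17), (100, 19), (1, 20), (1, 28)]),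
    (622, [(1, 22)]), (661, [(100, 7), (100, 13), (100, 27)]),
    (662, [(67, 8), (67, 14), (34, 16)]),
    (685, [(34, 8), (100, 11), (33, 14), (67, 16), (99, 17), (1, 19), (100, 20), (100, 28)]),
    (686, [(100, 18), (100, 22)]), (693, [(1, 17), (1, 20), (100, 23), (1, 28)]),
    (694, [(1, 18), (100, 24), (100, 29)]),
    (821, [(50, 8), (50, 11), (50, 14), (50, 16), (100, 17), (100, 28)]),
    (822, [(1, 21), (1, 22)]), (877, [(100, 29)]), (878, [(1, 25)])]
def rot10 : List (Bool × List Bool) := [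
    (false, wc 549), (true, wc 549), (true, wc 550), (true, wc 551), (false, wc 555),
    (true, wc 566), (true, wc 567), (true, wc 590), (true, wc 591), (true, wc 622),
    (true, wc 623)]
def tc10 : List (ℕ × List (ℕ × ℕ)) := [
    (1097, [(100, 0)]), (1098, [(50, 1)]), (1109, [(100, 4)]), (1110, [(1, 11)]),
    (1173, [(51, 1), (1, 2), (1, 4)]), (1174, [(1, 3), (100, 11)]),
    (1197, [(99, 3), (1, 7), (1, 11)]), (1198, [(1, 8)]),
    (1205, [(1, 3), (50, 5), (50, 7), (100, 11)]), (1206, [(50, 6), (50, 8)]),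
    (1389, [(51, 6), (50, 8), (100, 9)]), (1390, [(100, 10)])]
def gw32 : List (List Bool) := [
    [false], [true], [false, false], [false, true], [true, true], [false, false, false],
    [false, false, true], [false, true, true], [true, true, true], [false, false, false, false],
    [false, false, false, true], [false, false, true, true], [false, true, true, true],
    [true, true, true, true], [false, true, false, true],
    [false, false, true, false, false, true], [true, true, false, true, true, false],
    [false, false, false, true, true], [true, true, true, false, false],
    [false, false, true, true, false, true], [true, true, false, false, true, false],
    [false, false, false, true, true, false, true],
    [true, true, true, false, false, true, false],
    [false, false, false, true, true, false, false, true],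
    [true, true, true, false, false, true, true, false],
    [false, false, false, true, true, true, false, true],
    [true, true, true, false, false, false, true, false],
    [false, false, false, true, false, false, true, false, true],
    [false, false, true, true, false, true, false, false, true],
    [true, true, false, false, true, false, true, true, false],
    [true, true, true, false, true, true, false, true, false],
    [false, false, false, true, true, true, false, false, true, true]]

def env3 : Env := [[], [], [], []]
def env4 : Env := env3 ++ [rulesOf crt4]
def env5 : Env := env4 ++ [rulesOf crt5]
def env6 : Env := env5 ++ [rulesOf crt6]
def env7 : Env := env6 ++ [rulesOf crt7]
def env8 : Env := env7 ++ [rulesOf crt8]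
def env9 : Env := env8 ++ [rulesOf crt9]
def env10 : Env := env9 ++ [rulesOf crt10]
theorem ok4 : (inst4.all (fun i => !(i.a.isEmpty || i.b.isEmpty || i.c.isEmpty || i.e.isEmpty)) &&
    chkRules (inst4.map (vRel env3)) crt4) = true := by decide +kernel
theorem ok5 : (inst5.all (fun i => !(i.a.isEmpty || i.b.isEmpty || i.c.isEmpty || i.e.isEmpty)) &&
    chkRules (inst5.map (vRel env4)) crt5) = true := by decide +kernel
theorem ok6 : (inst6.all (fun i => !(i.a.isEmpty || i.b.isEmpty || i.c.isEmpty || i.e.isEmpty)) &&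
    chkRules (inst6.map (vRel env5)) crt6) = true := by decide +kernel
theorem ok7 : (inst7.all (fun i => !(i.a.isEmpty || i.b.isEmpty || i.c.isEmpty || i.e.isEmpty)) &&
    chkRules (inst7.map (vRel env6)) crt7) = true := by decide +kernel
theorem ok8 : (inst8.all (fun i => !(i.a.isEmpty || i.b.isEmpty || i.c.isEmpty || i.e.isEmpty)) &&
    chkRules (inst8.map (vRel env7)) crt8) = true := by decide +kernel
theorem ok9 : (inst9.all (fun i => !(i.a.isEmpty || i.b.isEmpty || i.c.isEmpty || i.e.isEmpty)) &&
    chkRules (inst9.map (vRel env8)) crt9) = true := by decide +kernel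
theorem ok10 : (inst10.all (fun i => !(i.a.isEmpty || i.b.isEmpty || i.c.isEmpty || i.e.isEmpty)) &&
    chkRules (inst10.map (vRel env9)) crt10) = true := by decide +kernel
theorem okT1 : (chkTr env10 rot1 (gw32.filter fun w => Nat.beq w.length 1) tc1 &&
    chkB env10 bas0 bas1 && bas0.all fun n => (tc1.map Prod.fst).contains (2 * n + 1) &&
    (tc1.map Prod.fst).contains (2 * n + 2)) = true := by decide +kernel
theorem okT2 : (chkTr env10 rot2 (gw32.filter fun w => Nat.beq w.length 2) tc2 &&
    chkB env10 bas1 bas2 && bas1.all fun n => (tc2.map Prod.fst).contains (2 * n + 1) &&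
    (tc2.map Prod.fst).contains (2 * n + 2)) = true := by decide +kernel
theorem okT3 : (chkTr env10 rot3 (gw32.filter fun w => Nat.beq w.length 3) tc3 &&
    chkB env10 bas2 bas3 && bas2.all fun n => (tc3.map Prod.fst).contains (2 * n + 1) &&
    (tc3.map Prod.fst).contains (2 * n + 2)) = true := by decide +kernel
theorem okT4 : (chkTr env10 rot4 (gw32.filter fun w => Nat.beq w.length 4) tc4 &&
    chkB env10 bas3 bas4 && bas3.all fun n => (tc4.map Prod.fst).contains (2 * n + 1) &&
    (tc4.map Prod.fst).contains (2 * n + 2)) = true := by decide +kernel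
theorem okT5 : (chkTr env10 rot5 (gw32.filter fun w => Nat.beq w.length 5) tc5 &&
    chkB env10 bas4 bas5 && bas4.all fun n => (tc5.map Prod.fst).contains (2 * n + 1) &&
    (tc5.map Prod.fst).contains (2 * n + 2)) = true := by decide +kernel
theorem okT6 : (chkTr env10 rot6 (gw32.filter fun w => Nat.beq w.length 6) tc6 &&
    chkB env10 bas5 bas6 && bas5.all fun n => (tc6.map Prod.fst).contains (2 * n + 1) &&
    (tc6.map Prod.fst).contains (2 * n + 2)) = true := by decide +kernel
theorem okT7 : (chkTr env10 rot7 (gw32.filter fun w => Nat.beq w.length 7) tc7 &&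
    chkB env10 bas6 bas7 && bas6.all fun n => (tc7.map Prod.fst).contains (2 * n + 1) &&
    (tc7.map Prod.fst).contains (2 * n + 2)) = true := by decide +kernel
theorem okT8 : (chkTr env10 rot8 (gw32.filter fun w => Nat.beq w.length 8) tc8 &&
    chkB env10 bas7 bas8 && bas7.all fun n => (tc8.map Prod.fst).contains (2 * n + 1) &&
    (tc8.map Prod.fst).contains (2 * n + 2)) = true := by decide +kernel
theorem okT9 : (chkTr env10 rot9 (gw32.filter fun w => Nat.beq w.length 9) tc9 &&
    chkB env10 bas8 bas9 && bas8.all fun n => (tc9.map Prod.fst).contains (2 * n + 1) &&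
    (tc9.map Prod.fst).contains (2 * n + 2)) = true := by decide +kernel
theorem okT10 : (chkTr env10 rot10 (gw32.filter fun w => Nat.beq w.length 10) tc10 &&
    chkB env10 bas9 bas10 && bas9.all fun n => (tc10.map Prod.fst).contains (2 * n + 1) &&
    (tc10.map Prod.fst).contains (2 * n + 2)) = true := by decide +kernel

theorem words_zero {W : Type*} [AddCommGroup W] (L : List Bool → W) (h101 : ∀ w : W, 101 • w = 0)
    (hc : ∀ u v, L (u ++ v) = L (v ++ u))
    (hsym : ∀ a b c e z, a ≠ [] → b ≠ [] → c ≠ [] → e ≠ [] → z ≠ [] → symSum L a b c e z = 0)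
    (hg : ∀ w ∈ gw32, L w = 0) (w : List Bool) (hw : w ≠ []) : L w = 0 := by
  have s3 : Sound L env3 := by
    intro blk hb r hr
    simp only [env3, List.mem_cons, List.not_mem_nil, or_false, or_self] at hb
    rw [hb] at hr
    simp at hr
  have s4 : Sound L env4 := by
    have h := ok4
    rw [Bool.and_eq_true] at h
    exact sound_snoc L h101 hc hsym _ s3 _ _ h.1 h.2
  have s5 : Sound L env5 := by
    have h := ok5
    rw [Bool.and_eq_true] at h
    exact sound_snoc L h101 hc hsym _ s4 _ _ h.1 h.2
  have s6 : Sound L env6 := by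
    have h := ok6
    rw [Bool.and_eq_true] at h
    exact sound_snoc L h101 hc hsym _ s5 _ _ h.1 h.2
  have s7 : Sound L env7 := by
    have h := ok7
    rw [Bool.and_eq_true] at h
    exact sound_snoc L h101 hc hsym _ s6 _ _ h.1 h.2
  have s8 : Sound L env8 := by
    have h := ok8
    rw [Bool.and_eq_true] at h
    exact sound_snoc L h101 hc hsym _ s7 _ _ h.1 h.2
  have s9 : Sound L env9 := by
    have h := ok9
    rw [Bool.and_eq_true] at h
    exact sound_snoc L h101 hc hsym _ s8 _ _ h.1 h.2
  have s10 : Sound L env10 := by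
    have h := ok10
    rw [Bool.and_eq_true] at h
    exact sound_snoc L h101 hc hsym _ s9 _ _ h.1 h.2
  have step : ∀ (k : ℕ) (B B' : List ℕ) rot tc, Spans L k B →
      (chkTr env10 rot (gw32.filter fun w => Nat.beq w.length (k + 1)) tc &&
        chkB env10 B B' && B.all fun n => (tc.map Prod.fst).contains (2 * n + 1) &&
        (tc.map Prod.fst).contains (2 * n + 2)) = true →
      (∀ w : List Bool, w.length = k + 1 → L w = 0) ∧ Spans L (k + 1) B' := by
    intro k B B' rot tc hB h
    rw [Bool.and_eq_true, Bool.and_eq_true] at h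
    refine ⟨?_, spans_succ L h101 env10 s10 k B B' hB h.1.2⟩
    refine zero_of_spans L k B hB (tc.map Prod.fst) ?_ h.2
    refine chk_tr L h101 hc env10 s10 rot _ tc ?_ h.1.1
    intro w hw
    exact hg w (List.mem_filter.1 hw).1
  have t0 := spans_zero L
  obtain ⟨z1, t1⟩ := step 0 bas0 bas1 _ _ t0 okT1
  obtain ⟨z2, t2⟩ := step 1 bas1 bas2 _ _ t1 okT2
  obtain ⟨z3, t3⟩ := step 2 bas2 bas3 _ _ t2 okT3
  obtain ⟨z4, t4⟩ := step 3 bas3 bas4 _ _ t3 okT4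
  obtain ⟨z5, t5⟩ := step 4 bas4 bas5 _ _ t4 okT5
  obtain ⟨z6, t6⟩ := step 5 bas5 bas6 _ _ t5 okT6
  obtain ⟨z7, t7⟩ := step 6 bas6 bas7 _ _ t6 okT7
  obtain ⟨z8, t8⟩ := step 7 bas7 bas8 _ _ t7 okT8
  obtain ⟨z9, t9⟩ := step 8 bas8 bas9 _ _ t8 okT9
  obtain ⟨z10, t10⟩ := step 9 bas9 bas10 _ _ t9 okT10
  have hpos := List.length_pos_iff.2 hw
  by_cases h : w.length ≤ 10
  · have : w.length ∈ Finset.Icc 1 10 := Finset.mem_Icc.2 ⟨hpos, h⟩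
    obtain ⟨n, hn⟩ : ∃ n, n = w.length := ⟨_, rfl⟩
    rw [← hn] at h hpos
    interval_cases n
    · exact z1 w hn.symm
    · exact z2 w hn.symm
    · exact z3 w hn.symm
    · exact z4 w hn.symm
    · exact z5 w hn.symm
    · exact z6 w hn.symm
    · exact z7 w hn.symm
    · exact z8 w hn.symm
    · exact z9 w hn.symm
    · exact z10 w hn.symm
  · obtain ⟨v, hv, hv2⟩ := t10 (w.take 10) (by simp; omega)
    have := hv2 (w.drop 10) (by
      intro h'
      have := List.drop_eq_nil_iff.1 h'
      omega)
    rw [List.take_append_drop] at this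
    rw [this]
    cases v with
    | nil => rfl
    | cons p t => exact absurd (hv p (by simp)) (by simp [bas10])

theorem all_traces {K : Type*} [Field K] [CharZero K] {R : Type*} [CommRing R] [Algebra K R]
    (X Y : Matrix (Fin 4) (Fin 4) R) (S : Subalgebra K R)
    (hg : ∀ w ∈ gw32, (wd X Y w).trace ∈ S) (w : List Bool) : (wd X Y w).trace ∈ S := by
  obtain ⟨d, hd⟩ : ∃ d, d = w.length := ⟨_, rfl⟩
  induction d using Nat.strong_induction_on generalizing w with
  | _ d ih =>
  have hS : ∀ w : List Bool, w.length < d → (wd X Y w).trace ∈ S := fun w hw => ih _ hw w rfl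
  by_cases hw0 : w = []
  · subst hw0
    have : (wd X Y []).trace = ((4 : ℕ) : R) := by
      simp [wd, Matrix.trace_one]
    rw [this]
    exact natCast_mem S 4
  let V := R ⧸ Subalgebra.toSubmodule S
  let q : R → V := Submodule.Quotient.mk
  let L : List Bool → V := fun u => if u.length = d then q ((wd X Y u).trace) else 0
  let M : Submodule ℤ V := Submodule.span ℤ (Set.range L)
  have hLM : ∀ u, L u ∈ M := fun u => Submodule.subset_span ⟨u, rfl⟩
  have hfg : M.FG := by
    have hfin : (Set.range L).Finite := by
      refine ((List.finite_length_eq Bool d).image L |>.insert 0).subset ?_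
      rintro _ ⟨u, rfl⟩
      by_cases h : u.length = d
      · exact Or.inr ⟨u, h, rfl⟩
      · left; simp [L, h]
    exact Submodule.fg_span hfin
  let I : Ideal ℤ := Ideal.span {101}
  let N : Submodule ℤ M := I • ⊤
  let L' : List Bool → M ⧸ N := fun u => Submodule.Quotient.mk ⟨L u, hLM u⟩
  have hL' : ∀ u, L' u = N.mkQ ⟨L u, hLM u⟩ := fun u => rfl
  have h101 : ∀ x : M ⧸ N, 101 • x = 0 := by
    intro x
    obtain ⟨y, rfl⟩ := Submodule.Quotient.mk_surjective _ x
    have : (Submodule.Quotient.mk ((101 : ℤ) • y) : M ⧸ N) = 0 := by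
      rw [Submodule.Quotient.mk_eq_zero]
      exact Submodule.smul_mem_smul (Ideal.subset_span rfl) trivial
    rw [← this, Submodule.Quotient.mk_smul]
    exact (natCast_zsmul _ 101).symm
  have hc : ∀ u v, L (u ++ v) = L (v ++ u) := by
    intro u v
    simp only [L, List.length_append, add_comm v.length, wd_append]
    rw [Matrix.trace_mul_comm]
  have hsym : ∀ a b c e z, a ≠ [] → b ≠ [] → c ≠ [] → e ≠ [] → z ≠ [] → symSum L a b c e z = 0 := by
    intro a b c e z ha hb hc he hz
    by_cases h : (z ++ a ++ b ++ c ++ e).length = d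
    · have := fti X Y S d hS a b c e z ha hb hc he hz h
      rw [← this]
      simp only [List.length_append] at h
      simp only [symSum, L]
      iterate 24 rw [if_pos (by simp only [List.length_append]; omega)]
    · simp only [List.length_append] at h
      simp only [symSum, L]
      iterate 24 rw [if_neg (by simp only [List.length_append]; omega)]
      simp
  have hsym' : ∀ a b c e z, a ≠ [] → b ≠ [] → c ≠ [] → e ≠ [] → z ≠ [] →
      symSum L' a b c e z = 0 := by
    intro a b c e z ha hb hc he hz
    have h := hsym a b c e z ha hb hc he hz
    simp only [symSum, hL', ← map_add]
    rw [← map_zero N.mkQ]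
    congr 1
    apply Subtype.ext
    exact h
  have hzero : ∀ u, u ≠ [] → L' u = 0 := by
    refine words_zero L' h101 ?_ hsym' ?_
    · intro u v
      simp only [L', hc u v]
    · intro u hu
      have : L u = 0 := by
        simp only [L]
        split_ifs with h
        · exact (Submodule.Quotient.mk_eq_zero _).2 (hg u hu)
        · rfl
      simp only [L', this]
      exact (Submodule.Quotient.mk_eq_zero _).2 N.zero_mem
  have hle : M ≤ I • M := by
    refine Submodule.span_le.2 ?_
    rintro _ ⟨u, rfl⟩
    by_cases hu : u = []
    · have : L u = 0 := by
        simp only [L]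
        rw [if_neg]
        subst hu
        rw [hd]
        simp only [List.length_nil]
        exact fun h => hw0 (List.length_eq_zero_iff.1 h.symm)
      rw [this]; exact Submodule.zero_mem _
    · have h := (Submodule.Quotient.mk_eq_zero _).1 (hzero u hu)
      have h2 := Submodule.mem_map_of_mem (f := M.subtype) h
      rw [Submodule.map_smul''] at h2
      simpa using h2
  obtain ⟨r, hr, hr2⟩ := Submodule.exists_sub_one_mem_and_smul_eq_zero_of_fg_of_le_smul I M hfg hle
  have hr0 : r ≠ 0 := by
    rintro rfl
    rw [Ideal.mem_span_singleton] at hr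
    norm_num at hr
  have hLw := hr2 (L w) (hLM w)
  have hq : q (wd X Y w).trace = 0 := by
    have h3 : L w = q (wd X Y w).trace := if_pos hd.symm
    rw [h3] at hLw
    have h4 : (r : K) • q (wd X Y w).trace = 0 := by
      rw [Int.cast_smul_eq_zsmul]; exact hLw
    exact (smul_eq_zero.1 h4).resolve_left (by exact_mod_cast hr0)
  exact (Submodule.Quotient.mk_eq_zero _).1 hq

theorem dcomm {K : Type*} [Field K] [CharZero K] {G I : Type*} [Group G] [Fintype G]
    [Fintype I] [DecidableEq I] (P : G →* Matrix I I K) (T : Matrix I I K)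
    (hT : ∀ Y : Matrix I I K, (∀ g, P g * Y = Y * P g) → T * Y = Y * T) :
    T ∈ Submodule.span K (Set.range P) := by
  set A := Submodule.span K (Set.range P) with hA
  obtain ⟨p0, hp0⟩ := A.subtype.exists_leftInverse_of_injective A.ker_subtype
  have hstab : ∀ g, ∀ M ∈ A, P g * M ∈ A := by
    intro g M hM
    induction hM using Submodule.span_induction with
    | mem x hx =>
      obtain ⟨h, rfl⟩ := hx
      rw [← map_mul]
      exact Submodule.subset_span ⟨_, rfl⟩
    | zero => simp
    | add x y _ _ hx hy => rw [mul_add]; exact A.add_mem hx hy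
    | smul c x _ hx => rw [Matrix.mul_smul]; exact A.smul_mem _ hx
  have hcard : (Fintype.card G : K) ≠ 0 := by
    exact_mod_cast Fintype.card_ne_zero
  let p : Matrix I I K →ₗ[K] Matrix I I K := (Fintype.card G : K)⁻¹ •
    ∑ g : G, (LinearMap.mulLeft K (P g⁻¹)) ∘ₗ A.subtype ∘ₗ p0 ∘ₗ (LinearMap.mulLeft K (P g))
  have hp : ∀ M, p M = (Fintype.card G : K)⁻¹ • ∑ g : G, P g⁻¹ * (p0 (P g * M) : Matrix I I K) := by
    intro M; simp [p]
  have hpA : ∀ M, p M ∈ A := by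
    intro M
    rw [hp]
    exact A.smul_mem _ (A.sum_mem fun g _ => hstab _ _ (p0 _).2)
  have hpid : ∀ M ∈ A, p M = M := by
    intro M hM
    rw [hp]
    have : ∀ g : G, P g⁻¹ * (p0 (P g * M) : Matrix I I K) = M := by
      intro g
      have := LinearMap.congr_fun hp0 ⟨P g * M, hstab g M hM⟩
      simp only [LinearMap.comp_apply, Submodule.subtype_apply, LinearMap.id_apply] at this
      rw [this, ← mul_assoc, ← map_mul]
      simp
    simp only [this, Finset.sum_const, Finset.card_univ]
    rw [← Nat.cast_smul_eq_nsmul K, smul_smul, inv_mul_cancel₀ hcard, one_smul]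
  have hpeq : ∀ h M, p (P h * M) = P h * p M := by
    intro h M
    rw [hp, hp, Matrix.mul_smul, Finset.mul_sum]
    congr 1
    rw [← Equiv.sum_comp (Equiv.mulRight h⁻¹)]
    refine Finset.sum_congr rfl fun g _ => ?_
    simp only [Equiv.coe_mulRight, _root_.mul_inv_rev, inv_inv, map_mul]
    rw [mul_assoc (P h), mul_assoc (P g), ← mul_assoc (P h⁻¹), ← map_mul P h⁻¹]
    simp
  let Y : I → I → Matrix I I K := fun α β => Matrix.of fun a c => p (Matrix.single c β 1) a α
  have hexp : ∀ (M : Matrix I I K) a α, p M a α = ∑ c, ∑ β, M c β * Y α β a c := by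
    intro M a α
    conv_lhs => rw [Matrix.matrix_eq_sum_single M]
    simp only [map_sum, Matrix.sum_apply]
    refine Finset.sum_congr rfl fun c _ => Finset.sum_congr rfl fun β _ => ?_
    have : Matrix.single c β (M c β) = M c β • Matrix.single c β 1 := by simp
    rw [this, map_smul]; rfl
  have hYc : ∀ α β g, P g * Y α β = Y α β * P g := by
    intro α β g
    ext a c
    have h := congrFun (congrFun (hpeq g (Matrix.single c β 1)) a) α
    rw [hexp] at h
    rw [Matrix.mul_apply] at h ⊢
    rw [Matrix.mul_apply]
    rw [show ∑ j, P g a j * Y α β j c = ∑ j, P g a j * p (Matrix.single c β 1) j α from rfl, ← h]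
    refine Finset.sum_congr rfl fun j _ => ?_
    rw [Finset.sum_eq_single β]
    · simp [mul_comm]
    · intro b _ hb
      rw [Matrix.mul_single_apply_of_ne]
      · simp
      · exact hb
    · simp
  have h1 : p 1 = 1 := hpid 1 (Submodule.subset_span ⟨1, map_one P⟩)
  have hfin : p T = T := by
    ext a α
    rw [hexp, Finset.sum_comm]
    have : ∀ β, ∑ c, T c β * Y α β a c = ∑ c, T a c * Y α β c β := by
      intro β
      have := congrFun (congrFun (hT (Y α β) (hYc α β)) a) β
      rw [Matrix.mul_apply, Matrix.mul_apply] at this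
      rw [this]
      exact Finset.sum_congr rfl fun c _ => mul_comm _ _
    simp only [this]
    rw [Finset.sum_comm]
    have h2 : ∀ c, ∑ β, Y α β c β = (1 : Matrix I I K) c α := by
      intro c
      rw [← h1, hexp]
      rw [Finset.sum_comm]
      refine Finset.sum_congr rfl fun β _ => ?_
      simp [Matrix.one_apply]
    simp only [← Finset.mul_sum, h2]
    rw [← Matrix.mul_apply, mul_one]
  rw [← hfin]
  exact hpA T

/-- exponent of a tuple of variables -/
def tExp {V : Type*} {m : ℕ} (u : Fin m → V) : V →₀ ℕ := ∑ k, Finsupp.single (u k) 1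

theorem tExp_perm {V : Type*} {m : ℕ} (u v : Fin m → V) (h : tExp u = tExp v) :
    ∃ σ : Equiv.Perm (Fin m), u = v ∘ σ := by
  classical
  have hc : ∀ c, Nonempty ({k // u k = c} ≃ {k // v k = c}) := by
    intro c
    rw [← Fintype.card_eq]
    have h2 := DFunLike.congr_fun h c
    simpa [tExp, Finsupp.finsetSum_apply, Finsupp.single_apply, Fintype.card_subtype] using h2
  let e := fun c => (hc c).some
  refine ⟨Equiv.ofFiberEquiv e, ?_⟩
  funext k
  exact (Equiv.ofFiberEquiv_map e k).symm

/-- polynomial attached to a tensor -/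
def tPoly (K : Type*) [Field K] {V : Type*} [Fintype V] (m : ℕ) :
    ((Fin m → V) → K) →ₗ[K] MvPolynomial V K where
  toFun c := ∑ u, c u • ∏ k, X (u k)
  map_add' c c' := by simp [add_smul, Finset.sum_add_distrib]
  map_smul' r c := by simp [Finset.smul_sum, smul_smul]

theorem tPoly_apply {K : Type*} [Field K] {V : Type*} [Fintype V] {m : ℕ} (c : (Fin m → V) → K) :
    tPoly K m c = ∑ u, c u • ∏ k, X (u k) := rfl

theorem prod_X_eq {K : Type*} [Field K] {V : Type*} {m : ℕ} (u : Fin m → V) :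
    (∏ k, X (u k) : MvPolynomial V K) = monomial (tExp u) 1 := by
  rw [tExp, monomial_sum_one]
  rfl

theorem tPoly_pair {K : Type*} [Field K] {V : Type*} [Fintype V] {m : ℕ}
    (c : (Fin m → V) → K) (h : tPoly K m c = 0) (Y : (Fin m → V) → K)
    (hY : ∀ (u : Fin m → V) (σ : Equiv.Perm (Fin m)), Y (u ∘ σ) = Y u) : ∑ u, c u * Y u = 0 := by
  classical
  let Y' : (V →₀ ℕ) → K := fun e => if h : ∃ u : Fin m → V, tExp u = e then Y h.choose else 0
  have hY' : ∀ u, Y' (tExp u) = Y u := by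
    intro u
    have hex : ∃ v : Fin m → V, tExp v = tExp u := ⟨u, rfl⟩
    simp only [Y', dif_pos hex]
    obtain ⟨σ, hσ⟩ := tExp_perm _ _ hex.choose_spec
    rw [hσ, hY]
  let Λ : MvPolynomial V K →ₗ[K] K := (MvPolynomial.basisMonomials V K).constr K Y'
  have hΛ : ∀ u : Fin m → V, Λ (∏ k, X (u k)) = Y u := by
    intro u
    rw [prod_X_eq, ← hY']
    have := (MvPolynomial.basisMonomials V K).constr_basis K Y' (tExp u)
    simpa [Λ] using this
  have := congrArg Λ h
  rw [tPoly_apply, map_sum, map_zero] at this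
  simpa [hΛ] using this

theorem tPoly_inj {K : Type*} [Field K] [CharZero K] {V : Type*} [Fintype V] {m : ℕ}
    (c : (Fin m → V) → K) (h : tPoly K m c = 0)
    (hc : ∀ (u : Fin m → V) (σ : Equiv.Perm (Fin m)), c (u ∘ σ) = c u) : c = 0 := by
  classical
  funext v
  have := tPoly_pair c h (fun u => ∑ σ : Equiv.Perm (Fin m), if u = v ∘ σ then 1 else 0) (by
    intro u τ
    rw [← Equiv.sum_comp (Equiv.mulRight τ)]
    refine Finset.sum_congr rfl fun σ _ => ?_
    have : (u ∘ τ = v ∘ (Equiv.mulRight τ) σ) ↔ u = v ∘ σ := by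
      constructor
      · intro h
        funext k
        have := congrFun h (τ⁻¹ k)
        simpa using this
      · rintro rfl
        rfl
    simp only [this])
  simp only [Finset.mul_sum] at this
  rw [Finset.sum_comm] at this
  simp only [mul_ite, mul_one, mul_zero, Finset.sum_ite_eq', Finset.mem_univ, if_true, hc,
    Finset.sum_const, Finset.card_univ, Fintype.card_perm, Fintype.card_fin, nsmul_eq_mul,
    mul_eq_zero, Nat.cast_eq_zero, Nat.factorial_ne_zero, false_or] at this
  simpa using this

theorem tPoly_exists {K : Type*} [Field K] [CharZero K] {V : Type*} [Fintype V] {m : ℕ}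
    (f : MvPolynomial V K) (hf : f.IsHomogeneous m) : ∃ c : (Fin m → V) → K,
    (∀ (u : Fin m → V) (σ : Equiv.Perm (Fin m)), c (u ∘ σ) = c u) ∧ tPoly K m c = f := by
  classical
  have h1 : f ∈ LinearMap.range (tPoly K (V := V) m) := by
    rw [← support_sum_monomial_coeff f]
    refine Submodule.sum_mem _ fun e he => ?_
    have hdeg : e.degree = m := by
      have := hf (mem_support_iff.1 he)
      rw [Finsupp.degree_eq_weight_one]
      exact this
    have hlen : (Finsupp.toMultiset e).toList.length = m := by
      rw [Multiset.length_toList, Finsupp.card_toMultiset, ← hdeg, Finsupp.degree]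
      rfl
    let u : Fin m → V := fun k => (Finsupp.toMultiset e).toList.get (k.cast hlen.symm)
    have hu : tExp u = e := by
      apply Multiset.toFinsupp.symm.injective
      change Finsupp.toMultiset (tExp u) = Finsupp.toMultiset e
      rw [tExp, map_sum]
      simp only [Finsupp.toMultiset_single, one_smul]
      conv_rhs => rw [← Multiset.coe_toList (Finsupp.toMultiset e)]
      have h3 : (Finsupp.toMultiset e).toList = List.ofFn u := by
        subst hlen
        exact (List.ofFn_get _).symm
      rw [h3, ← Fin.univ_val_map, ← Multiset.sum_map_singleton (Finset.univ.val.map u),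
        Multiset.map_map]
      rfl
    refine ⟨Pi.single u (coeff e f), ?_⟩
    rw [tPoly_apply, Finset.sum_eq_single u]
    · rw [Pi.single_eq_same, prod_X_eq, hu, smul_monomial, smul_eq_mul, mul_one]
    · intro b _ hb; simp [hb]
    · simp
  obtain ⟨c, hc⟩ := h1
  refine ⟨fun u => ((m.factorial : ℕ) : K)⁻¹ * ∑ σ : Equiv.Perm (Fin m), c (u ∘ σ), ?_, ?_⟩
  · intro u τ
    refine congrArg (fun t => ((m.factorial : ℕ) : K)⁻¹ * t) ?_
    rw [← Equiv.sum_comp (Equiv.mulLeft τ⁻¹)]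
    refine Finset.sum_congr rfl fun σ _ => ?_
    congr 1
    funext k
    simp
  · rw [tPoly_apply]
    simp only [mul_smul, Finset.sum_smul]
    rw [← Finset.smul_sum, Finset.sum_comm]
    have : ∀ σ : Equiv.Perm (Fin m), ∑ u : Fin m → V,
        c (u ∘ σ) • (∏ k, X (u k) : MvPolynomial V K) = f := by
      intro σ
      rw [← hc, tPoly_apply, ← Equiv.sum_comp (Equiv.arrowCongr σ (Equiv.refl V))]
      refine Finset.sum_congr rfl fun u _ => ?_
      congr 1
      · congr 1
        funext k
        simp
      · rw [← Equiv.prod_comp σ]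
        simp
    simp only [this, Finset.sum_const, Finset.card_univ, Fintype.card_perm, Fintype.card_fin]
    rw [← Nat.cast_smul_eq_nsmul K, smul_smul, inv_mul_cancel₀, one_smul]
    exact_mod_cast Nat.factorial_ne_zero m

theorem tPoly_subst {K : Type*} [Field K] {V W : Type*} [Fintype V] [Fintype W] {m : ℕ}
    (A : V → W → K) (c : (Fin m → V) → K) :
    aeval (fun v => ∑ w, A v w • (X w : MvPolynomial W K)) (tPoly K m c) =
      tPoly K m (fun w => ∑ v, c v * ∏ k, A (v k) (w k)) := by
  classical
  rw [tPoly_apply, tPoly_apply, map_sum]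
  simp only [map_smul, map_prod, aeval_X, Finset.sum_smul, mul_smul]
  rw [Finset.sum_comm]
  refine Finset.sum_congr rfl fun v _ => ?_
  rw [Finset.prod_univ_sum, Fintype.piFinset_univ, Finset.smul_sum]
  refine Finset.sum_congr rfl fun w _ => ?_
  rw [Finset.prod_smul]

theorem tPoly_hom {K : Type*} [Field K] {V : Type*} [Fintype V] {m : ℕ}
    (c : (Fin m → V) → K) : (tPoly K m c).IsHomogeneous m := by
  rw [tPoly_apply]
  refine IsHomogeneous.sum _ _ _ fun u _ => ?_
  have h : (∏ k, X (u k) : MvPolynomial V K).IsHomogeneous (∑ k : Fin m, 1) :=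
    IsHomogeneous.prod _ _ _ fun k _ => isHomogeneous_X K (u k)
  rw [smul_eq_C_mul]
  simpa using (isHomogeneous_C V (c u)).mul h

theorem comp_subst {K : Type*} [Field K] [CharZero K] {V : Type*} [Fintype V] (m : ℕ)
    (A : V → V → K) (f : MvPolynomial V K) :
    homogeneousComponent m (aeval (fun v => ∑ w, A v w • (X w : MvPolynomial V K)) f) =
      aeval (fun v => ∑ w, A v w • (X w : MvPolynomial V K)) (homogeneousComponent m f) := by
  have hh : ∀ i, (aeval (fun v => ∑ w, A v w • (X w : MvPolynomial V K))
      (homogeneousComponent i f)).IsHomogeneous i := by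
    intro i
    obtain ⟨c, _, hc⟩ := tPoly_exists _ (homogeneousComponent_isHomogeneous i f)
    rw [← hc, tPoly_subst]
    exact tPoly_hom _
  conv_lhs => rw [← sum_homogeneousComponent f]
  rw [map_sum, map_sum]
  by_cases hm : m ∈ Finset.range (f.totalDegree + 1)
  · rw [Finset.sum_eq_single m]
    · rw [homogeneousComponent_of_mem (hh m), if_pos rfl]
    · intro b _ hb
      rw [homogeneousComponent_of_mem (hh b), if_neg hb.symm]
    · intro h; exact absurd hm h
  · rw [homogeneousComponent_eq_zero m f (by simpa using hm), map_zero]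
    refine Finset.sum_eq_zero fun b hb => ?_
    rw [homogeneousComponent_of_mem (hh b), if_neg]
    rintro rfl
    exact hm hb

/-- variable with given letter and indices -/
def mv {n : ℕ} (s : Bool) (i j : Fin n) : MatVar n := if s then Sum.inr (i, j) else Sum.inl (i, j)

theorem sum_mv {n m : ℕ} {M : Type*} [AddCommMonoid M] (F : (Fin m → MatVar n) → M) :
    ∑ u, F u = ∑ s : Fin m → Bool, ∑ i : Fin m → Fin n, ∑ j : Fin m → Fin n,
      F (fun k => mv (s k) (i k) (j k)) := by
  let e1 : (Fin m → Bool) × (Fin m → Fin n) × (Fin m → Fin n) ≃ (Fin m → MatVar n) :=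
    { toFun := fun t k => mv (t.1 k) (t.2.1 k) (t.2.2 k)
      invFun := fun u => (fun k => Sum.isRight (u k), fun k => (Sum.elim id id (u k)).1,
        fun k => (Sum.elim id id (u k)).2)
      left_inv := by
        rintro ⟨s, i, j⟩
        ext k
        · cases h : s k <;> simp [mv, h]
        · cases h : s k <;> simp [mv, h]
        · cases h : s k <;> simp [mv, h]
      right_inv := by
        intro u
        funext k
        cases h : u k <;> simp [mv, h] }
  rw [← Equiv.sum_comp e1, Fintype.sum_prod_type]
  refine Finset.sum_congr rfl fun s _ => ?_
  rw [Fintype.sum_prod_type]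
  rfl

/-- left multiplication -/
def lA {K : Type*} [Field K] {n : ℕ} (g : Matrix (Fin n) (Fin n) K) : MatVar n → MatVar n → K
  | Sum.inl p, Sum.inl q => if p.2 = q.2 then g p.1 q.1 else 0
  | Sum.inr p, Sum.inr q => if p.2 = q.2 then g p.1 q.1 else 0
  | _, _ => 0

/-- right multiplication -/
def rA {K : Type*} [Field K] {n : ℕ} (g : Matrix (Fin n) (Fin n) K) : MatVar n → MatVar n → K
  | Sum.inl p, Sum.inl q => if p.1 = q.1 then g q.2 p.2 else 0
  | Sum.inr p, Sum.inr q => if p.1 = q.1 then g q.2 p.2 else 0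
  | _, _ => 0

theorem lA_mv {K : Type*} [Field K] {n : ℕ} (g : Matrix (Fin n) (Fin n) K) (s t : Bool)
    (i j a b : Fin n) : lA g (mv s i j) (mv t a b) = if s = t ∧ j = b then g i a else 0 := by
  cases s <;> cases t <;> simp [mv, lA]

theorem rA_mv {K : Type*} [Field K] {n : ℕ} (g : Matrix (Fin n) (Fin n) K) (s t : Bool)
    (i j a b : Fin n) : rA g (mv s i j) (mv t a b) = if s = t ∧ i = a then g b j else 0 := by
  cases s <;> cases t <;> simp [mv, rA]

theorem map_aeval_aux {K : Type*} [Field K] {V W : Type*} (x : W → K)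
    (φ : V → MvPolynomial W K) (f : MvPolynomial V K) :
    aeval x (aeval φ f) = aeval (fun v => aeval x (φ v)) f := by
  rw [comp_aeval_apply φ (aeval x) f]

theorem prod_ite_and {K : Type*} [Field K] {m : ℕ} {α β : Type*} [DecidableEq α] [DecidableEq β]
    (a b : Fin m → α) (c e : Fin m → β) (F : Fin m → K) :
    (∏ k, if a k = b k ∧ c k = e k then F k else 0) =
      if a = b then (if c = e then ∏ k, F k else 0) else 0 := by
  rw [Finset.prod_ite_zero]
  by_cases h1 : a = b
  · by_cases h2 : c = e
    · simp [h1, h2]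
    · rw [if_pos h1, if_neg h2, if_neg]
      intro h
      exact h2 (funext fun k => (h k (Finset.mem_univ k)).2)
  · rw [if_neg h1, if_neg]
    intro h
    exact h1 (funext fun k => (h k (Finset.mem_univ k)).1)

theorem lA_eval {K : Type*} [Field K] {n : ℕ} (g A B : Matrix (Fin n) (Fin n) K)
    (f : MvPolynomial (MatVar n) K) :
    eval (pairSub A B) (aeval (fun v => ∑ w, lA g v w • (X w : MvPolynomial (MatVar n) K)) f) =
      eval (pairSub (g * A) (g * B)) f := by
  rw [← coe_aeval_eq_eval, ← coe_aeval_eq_eval]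
  simp only [RingHom.coe_coe]
  rw [map_aeval_aux]
  congr 2
  funext v
  rcases v with ⟨i, j⟩ | ⟨i, j⟩ <;>
    simp [pairSub, lA, Fintype.sum_prod_type, Matrix.mul_apply]

theorem rA_eval {K : Type*} [Field K] {n : ℕ} (g A B : Matrix (Fin n) (Fin n) K)
    (f : MvPolynomial (MatVar n) K) :
    eval (pairSub A B) (aeval (fun v => ∑ w, rA g v w • (X w : MvPolynomial (MatVar n) K)) f) =
      eval (pairSub (A * g) (B * g)) f := by
  rw [← coe_aeval_eq_eval, ← coe_aeval_eq_eval]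
  simp only [RingHom.coe_coe]
  rw [map_aeval_aux]
  congr 2
  funext v
  rcases v with ⟨i, j⟩ | ⟨i, j⟩ <;>
    simp [pairSub, rA, Fintype.sum_prod_type, Matrix.mul_apply, mul_comm, Finset.sum_ite_irrel]

theorem pairSub_surj {K : Type*} [Field K] {n : ℕ} (x : MatVar n → K) :
    ∃ A B, x = pairSub A B :=
  ⟨fun i j => x (Sum.inl (i, j)), fun i j => x (Sum.inr (i, j)), by
    funext v; rcases v with v | v <;> rfl⟩

theorem inv_subst {K : Type*} [Field K] [CharZero K] {n : ℕ} (f : MvPolynomial (MatVar n) K)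
    (hf : IsMatInvariant f) (g : Matrix (Fin n) (Fin n) K) (hg : IsUnit g.det) :
    aeval (fun v => ∑ w, lA g v w • (X w : MvPolynomial (MatVar n) K)) f =
    aeval (fun v => ∑ w, rA g v w • (X w : MvPolynomial (MatVar n) K)) f := by
  apply MvPolynomial.funext
  intro x
  obtain ⟨A, B, rfl⟩ := pairSub_surj x
  rw [lA_eval, rA_eval]
  have := hf (Matrix.GeneralLinearGroup.mk'' g hg) (A * g) (B * g)
  rw [← this]
  have h1 : ∀ A : Matrix (Fin n) (Fin n) K,
      ((Matrix.GeneralLinearGroup.mk'' g hg : GL (Fin n) K) : Matrix (Fin n) (Fin n) K) * (A * g) *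
      (((Matrix.GeneralLinearGroup.mk'' g hg)⁻¹ : GL (Fin n) K) : Matrix (Fin n) (Fin n) K)
      = g * A := by
    intro A
    have h2 : g * (((Matrix.GeneralLinearGroup.mk'' g hg)⁻¹ : GL (Fin n) K) :
        Matrix (Fin n) (Fin n) K) = 1 :=
      Units.mul_inv (Matrix.GeneralLinearGroup.mk'' g hg)
    change g * (A * g) * _ = _
    rw [Matrix.mul_assoc, Matrix.mul_assoc, h2, Matrix.mul_one]
  rw [h1, h1]

/-- slice of a tensor -/
def sl {K : Type*} {n m : ℕ} (d : (Fin m → MatVar n) → K) (s : Fin m → Bool) :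
    Matrix (Fin m → Fin n) (Fin m → Fin n) K := fun i j => d (fun k => mv (s k) (i k) (j k))

theorem sl_comm {K : Type*} [Field K] [CharZero K] {n m : ℕ} (f : MvPolynomial (MatVar n) K)
    (hf : IsMatInvariant f) (d : (Fin m → MatVar n) → K)
    (hd : ∀ (u : Fin m → MatVar n) (σ : Equiv.Perm (Fin m)), d (u ∘ σ) = d u)
    (hdf : tPoly K m d = homogeneousComponent m f)
    (g : Matrix (Fin n) (Fin n) K) (hg : IsUnit g.det) (s : Fin m → Bool)
    (l j : Fin m → Fin n) :
    ∑ i, sl d s i j * ∏ k, g (i k) (l k) = ∑ i, sl d s l i * ∏ k, g (j k) (i k) := by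
  classical
  have h1 := congrArg (homogeneousComponent m) (inv_subst f hf g hg)
  rw [comp_subst, comp_subst, ← hdf, tPoly_subst, tPoly_subst, ← sub_eq_zero, ← map_sub] at h1
  have hsym : ∀ (A : MatVar n → MatVar n → K) (w : Fin m → MatVar n) (σ : Equiv.Perm (Fin m)),
      ∑ v, d v * ∏ k, A (v k) ((w ∘ σ) k) = ∑ v, d v * ∏ k, A (v k) (w k) := by
    intro A w σ
    rw [← Equiv.sum_comp (Equiv.arrowCongr σ.symm (Equiv.refl (MatVar n)))]
    refine Finset.sum_congr rfl fun v _ => ?_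
    have h2 : (Equiv.arrowCongr σ.symm (Equiv.refl (MatVar n))) v = v ∘ σ := rfl
    rw [h2, hd]
    congr 1
    exact Equiv.prod_comp σ (fun k => A (v k) (w k))
  have h2 := tPoly_inj _ h1 (by
    intro u σ
    simp only [Pi.sub_apply, hsym])
  have h3 := congrFun h2 (fun k => mv (s k) (l k) (j k))
  simp only [Pi.sub_apply, Pi.zero_apply, sub_eq_zero] at h3
  rw [sum_mv, sum_mv] at h3
  simp only [lA_mv, rA_mv, prod_ite_and, mul_ite, mul_zero] at h3
  simpa [sl, Finset.sum_ite_irrel] using h3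

/-- permutation matrices on tensor space -/
def pM (K : Type*) [Field K] (n m : ℕ) :
    Equiv.Perm (Fin m) →* Matrix (Fin m → Fin n) (Fin m → Fin n) K where
  toFun σ := Matrix.of fun a b => if a ∘ σ = b then 1 else 0
  map_one' := by
    ext a b
    simp [Matrix.one_apply]
  map_mul' σ τ := by
    ext a b
    rw [Matrix.mul_apply]
    simp only [Matrix.of_apply, ite_mul, one_mul, zero_mul, Finset.sum_ite_eq, Finset.mem_univ,
      if_true]
    rfl

theorem pM_apply {K : Type*} [Field K] {n m : ℕ} (σ : Equiv.Perm (Fin m)) (a b : Fin m → Fin n) :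
    pM K n m σ a b = if a ∘ σ = b then 1 else 0 := rfl

theorem pM_comm {K : Type*} [Field K] {n m : ℕ} (Y : Matrix (Fin m → Fin n) (Fin m → Fin n) K)
    (σ : Equiv.Perm (Fin m)) (h : pM K n m σ * Y = Y * pM K n m σ) (a b : Fin m → Fin n) :
    Y (a ∘ σ) (b ∘ σ) = Y a b := by
  have h1 := congrFun (congrFun h a) (b ∘ σ)
  rw [Matrix.mul_apply, Matrix.mul_apply] at h1
  have h2 : ∀ c : Fin m → Fin n, (c ∘ σ = b ∘ σ) ↔ c = b := by
    intro c
    constructor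
    · intro h
      funext k
      simpa using congrFun h (σ⁻¹ k)
    · rintro rfl; rfl
  simpa [pM_apply, h2] using h1

theorem sl_comm2 {K : Type*} [Field K] [CharZero K] {n m : ℕ}
    (D : Matrix (Fin m → Fin n) (Fin m → Fin n) K)
    (hD : ∀ g : Matrix (Fin n) (Fin n) K, IsUnit g.det → ∀ l j : Fin m → Fin n,
      ∑ i, D i j * ∏ k, g (i k) (l k) = ∑ i, D l i * ∏ k, g (j k) (i k))
    (Y : Matrix (Fin m → Fin n) (Fin m → Fin n) K)
    (hY : ∀ (σ : Equiv.Perm (Fin m)) a b, Y (a ∘ σ) (b ∘ σ) = Y a b) (l j : Fin m → Fin n) :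
    ∑ i, D i j * Y i l = ∑ i, D l i * Y j i := by
  classical
  have hsum : ∀ {M : Type _} [AddCommMonoid M] (F : (Fin m → Fin n × Fin n) → M),
      ∑ u, F u = ∑ a : Fin m → Fin n, ∑ b : Fin m → Fin n, F (fun k => (a k, b k)) := by
    intro M _ F
    rw [← Equiv.sum_comp (Equiv.arrowProdEquivProdArrow (Fin m) (fun _ => Fin n)
      (fun _ => Fin n)).symm, Fintype.sum_prod_type]
    rfl
  let φ : (Fin m → Fin n × Fin n) → K := fun u =>
    (if (fun k => (u k).2) = l then D (fun k => (u k).1) j else 0) -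
    (if (fun k => (u k).1) = j then D l (fun k => (u k).2) else 0)
  have hφ : ∀ Z : (Fin m → Fin n × Fin n) → K, ∑ u, φ u * Z u =
      ∑ i, D i j * Z (fun k => (i k, l k)) - ∑ i, D l i * Z (fun k => (j k, i k)) := by
    intro Z
    rw [hsum]
    simp [φ, sub_mul, Finset.sum_sub_distrib, Finset.sum_ite_irrel]
  have hQ : tPoly K m φ = 0 := by
    have h1 : tPoly K m φ * (Matrix.mvPolynomialX (Fin n) (Fin n) K).det = 0 := by
      apply MvPolynomial.funext
      intro x
      rw [map_mul, map_zero]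
      by_cases hdet : eval x (Matrix.mvPolynomialX (Fin n) (Fin n) K).det = 0
      · rw [hdet, mul_zero]
      · have h2 : eval x (Matrix.mvPolynomialX (Fin n) (Fin n) K).det =
            Matrix.det (fun i j => x (i, j)) := by
          rw [RingHom.map_det]
          congr 1
          ext i j
          simp [Matrix.mvPolynomialX]
        have h3 := hD (fun i j => x (i, j)) (by rw [← h2]; exact isUnit_iff_ne_zero.2 hdet) l j
        have h4 : eval x (tPoly K m φ) = ∑ u, φ u * ∏ k, x (u k) := by
          rw [tPoly_apply, map_sum]
          simp [smul_eval]
        rw [h4, hφ, h3, sub_self, zero_mul]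
    exact (mul_eq_zero.1 h1).resolve_right (Matrix.det_mvPolynomialX_ne_zero _ _)
  have h5 := tPoly_pair φ hQ (fun u => Y (fun k => (u k).1) (fun k => (u k).2)) (by
    intro u σ
    exact hY σ (fun k => (u k).1) (fun k => (u k).2))
  rw [hφ] at h5
  exact sub_eq_zero.1 h5

theorem span_mem {K : Type*} [Field K] [CharZero K] {n m : ℕ}
    (S : Subalgebra K (MvPolynomial (MatVar n) K))
    (hS : ∀ w, (wd (genX K n) (genY K n) w).trace ∈ S) (s : Fin m → Bool)
    (D : Matrix (Fin m → Fin n) (Fin m → Fin n) K)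
    (h2 : D ∈ Submodule.span K (Set.range (pM K n m))) :
    ∑ i, ∑ j, D i j • (∏ k, X (mv (s k) (i k) (j k)) : MvPolynomial (MatVar n) K) ∈ S := by
  refine Submodule.span_induction (p := fun (D : Matrix (Fin m → Fin n) (Fin m → Fin n) K) _ =>
    ∑ i, ∑ j, D i j • (∏ k, X (mv (s k) (i k) (j k)) : MvPolynomial (MatVar n) K) ∈ S)
    ?_ ?_ ?_ ?_ h2
  · rintro _ ⟨σ, rfl⟩
    have h3 := tperm_mem (genX K n) (genY K n) S hS m σ (fun k => [s k])
    have h4 : tperm σ (fun k => wd (genX K n) (genY K n) [s k]) = ∑ i, ∑ j, pM K n m σ i j •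
        (∏ k, X (mv (s k) (i k) (j k)) : MvPolynomial (MatVar n) K) := by
      rw [tperm]
      refine Finset.sum_congr rfl fun i _ => ?_
      simp only [pM_apply, ite_smul, one_smul, zero_smul,
        Finset.sum_ite_eq, Finset.mem_univ, if_true]
      refine Finset.prod_congr rfl fun k _ => ?_
      cases h : s k <;> simp [wd, mv, genX, genY]
    exact h4 ▸ h3
  · simp [S.zero_mem]
  · intro x y _ _ hx hy
    simpa [add_smul, Finset.sum_add_distrib] using S.add_mem hx hy
  · intro r x _ hx
    have := S.smul_mem hx r
    simpa [Finset.smul_sum, smul_smul] using this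

theorem fft {K : Type*} [Field K] [CharZero K] {n : ℕ} (f : MvPolynomial (MatVar n) K)
    (hf : IsMatInvariant f) (S : Subalgebra K (MvPolynomial (MatVar n) K))
    (hS : ∀ w, (wd (genX K n) (genY K n) w).trace ∈ S) : f ∈ S := by
  rw [← sum_homogeneousComponent f]
  refine S.sum_mem fun m _ => ?_
  obtain ⟨d, hd, hdf⟩ := tPoly_exists _ (homogeneousComponent_isHomogeneous m f)
  rw [← hdf, tPoly_apply, sum_mv]
  refine S.sum_mem fun s _ => ?_
  have h1 := sl_comm2 (sl d s) (fun g hg l j => sl_comm f hf d hd hdf g hg s l j)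
  refine span_mem S hS s (sl d s) ?_
  refine dcomm _ _ fun Y hY => ?_
  ext l j
  have := h1 Yᵀ (fun σ a b => pM_comm Y σ (hY σ) b a) l j
  rw [Matrix.mul_apply, Matrix.mul_apply]
  simp only [Matrix.transpose_apply] at this
  rw [← this]
  exact Finset.sum_congr rfl fun i _ => mul_comm _ _

theorem gens32_gw (K : Type*) [Field K] (i : Fin 32) :
    gens32 K i = (wd (genX K 4) (genY K 4) (gw32.getD i [])).trace := by
  fin_cases i <;>
    simp [gens32, wd, gw32, pow_succ, Matrix.mul_assoc]

theorem wd_map {R S : Type*} [CommRing R] [CommRing S] (φ : R →+* S) {n : ℕ}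
    (X Y : Matrix (Fin n) (Fin n) R) (w : List Bool) :
    (wd X Y w).map φ = wd (X.map φ) (Y.map φ) w := by
  induction w with
  | nil => simp [wd]
  | cons b w ih =>
    simp only [wd, List.map_cons, List.prod_cons] at ih ⊢
    rw [Matrix.map_mul, ih]
    cases b <;> rfl

theorem wd_conj {R : Type*} [CommRing R] {n : ℕ} (g h X Y : Matrix (Fin n) (Fin n) R)
    (hg : h * g = 1) (hh : g * h = 1) (w : List Bool) :
    wd (g * X * h) (g * Y * h) w = g * wd X Y w * h := by
  induction w with
  | nil => simp [wd, hh]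
  | cons b w ih =>
    simp only [wd, List.map_cons, List.prod_cons] at ih ⊢
    rw [ih]
    have h1 : ∀ A B : Matrix (Fin n) (Fin n) R, g * A * h * (g * B * h) = g * (A * B) * h := by
      intro A B
      calc g * A * h * (g * B * h) = g * A * (h * g) * B * h := by simp only [Matrix.mul_assoc]
        _ = _ := by rw [hg]; simp only [Matrix.mul_assoc, Matrix.one_mul]
    cases b <;> simp only [if_true, if_false, Bool.false_eq_true, h1]

theorem eval_wd {K : Type*} [Field K] {n : ℕ} (A B : Matrix (Fin n) (Fin n) K) (w : List Bool) :
    eval (pairSub A B) (wd (genX K n) (genY K n) w).trace = (wd A B w).trace := by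
  rw [AddMonoidHom.map_trace]
  have := wd_map (eval (pairSub A B)) (genX K n) (genY K n) w
  rw [this]
  congr 2
  · ext i j; simp [genX, pairSub]
  · ext i j; simp [genY, pairSub]

theorem wd_mem {K : Type*} [Field K] {n : ℕ} (w : List Bool) :
    (wd (genX K n) (genY K n) w).trace ∈ pureAlg K n := by
  intro a A B
  rw [eval_wd, eval_wd, wd_conj _ _ _ _ (Units.inv_mul a) (Units.mul_inv a), Matrix.trace_mul_comm,
    ← Matrix.mul_assoc]
  rw [Units.inv_mul a, Matrix.one_mul]

theorem adjoin_eq (K : Type*) [Field K] [CharZero K] :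
    Algebra.adjoin K (Set.range (gens32 K)) = pureAlg K 4 := by
  apply le_antisymm
  · rw [Algebra.adjoin_le_iff]
    rintro _ ⟨i, rfl⟩
    rw [gens32_gw]
    exact wd_mem _
  · intro f hf
    refine fft f hf _ fun w => ?_
    refine all_traces _ _ _ (fun w hw => ?_) w
    obtain ⟨i, hi, rfl⟩ := List.mem_iff_getElem.1 hw
    refine Algebra.subset_adjoin ⟨⟨i, hi⟩, ?_⟩
    rw [gens32_gw, List.getD_eq_getElem]

/-- integer 4-vectors as nested pairs -/
abbrev Q4 (α : Type) := α × α × α × α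

/-- coordinates -/
def qv {α : Type} (q : Q4 α) : Fin 4 → α := ![q.1, q.2.1, q.2.2.1, q.2.2.2]

/-- the matrix with given rows -/
def qm (M : Q4 (Q4 ℤ)) : Matrix (Fin 4) (Fin 4) ℤ := Matrix.of fun i => qv (qv M i)

/-- the nilpotent Jordan block -/
def jm : Matrix (Fin 4) (Fin 4) ℤ := !![0, 1, 0, 0; 0, 0, 1, 0; 0, 0, 0, 1; 0, 0, 0, 0]

/-- row vector times the Jordan block or a matrix -/
def qstep (M : Q4 (Q4 ℤ)) (b : Bool) (v : Q4 ℤ) : Q4 ℤ :=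
  match b, v, M with
  | false, (a, b, c, _), _ => (0, a, b, c)
  | true, (a, b, c, d), ((p0, p1, p2, p3), (q0, q1, q2, q3), (r0, r1, r2, r3), (s0, s1, s2, s3)) =>
    (a * p0 + b * q0 + c * r0 + d * s0, a * p1 + b * q1 + c * r1 + d * s1,
     a * p2 + b * q2 + c * r2 + d * s2, a * p3 + b * q3 + c * r3 + d * s3)

/-- row vector times a word -/
def qrun (M : Q4 (Q4 ℤ)) : List Bool → Q4 ℤ → Q4 ℤ
  | [], v => v
  | b :: w, v => qrun M w (qstep M b v)

/-- trace of a word -/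
def qtr (M : Q4 (Q4 ℤ)) (w : List Bool) : ℤ :=
  (qrun M w (1, 0, 0, 0)).1 + (qrun M w (0, 1, 0, 0)).2.1 + (qrun M w (0, 0, 1, 0)).2.2.1 +
    (qrun M w (0, 0, 0, 1)).2.2.2

theorem qstep_eq (M : Q4 (Q4 ℤ)) (b : Bool) (v : Q4 ℤ) :
    qv (qstep M b v) = qv v ᵥ* (if b then qm M else jm) := by
  obtain ⟨a, c, d, e⟩ := v
  obtain ⟨⟨p0, p1, p2, p3⟩, ⟨q0, q1, q2, q3⟩, ⟨r0, r1, r2, r3⟩, ⟨s0, s1, s2, s3⟩⟩ := M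
  cases b <;> ext i <;> fin_cases i <;>
    simp [qstep, qv, qm, jm, Matrix.vecMul, dotProduct, Fin.sum_univ_four]

theorem qrun_eq (M : Q4 (Q4 ℤ)) (w : List Bool) : ∀ v : Q4 ℤ,
    qv (qrun M w v) = qv v ᵥ* wd jm (qm M) w := by
  induction w with
  | nil => intro v; simp [qrun, wd]
  | cons b w ih =>
    intro v
    rw [qrun, ih, qstep_eq, Matrix.vecMul_vecMul]
    simp [wd]

theorem qtr_eq (M : Q4 (Q4 ℤ)) (w : List Bool) : qtr M w = (wd jm (qm M) w).trace := by
  have h : ∀ (v : Q4 ℤ) (j : Fin 4), qv (qrun M w v) j = (qv v ᵥ* wd jm (qm M) w) j :=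
    fun v j => congrFun (qrun_eq M w v) j
  have h0 := h (1, 0, 0, 0) 0
  have h1 := h (0, 1, 0, 0) 1
  have h2 := h (0, 0, 1, 0) 2
  have h3 := h (0, 0, 0, 1) 3
  simp [qv, Matrix.vecMul, dotProduct, Fin.sum_univ_four] at h0 h1 h2 h3
  rw [qtr, Matrix.trace, Fin.sum_univ_four, h0, h1, h2, h3]
  rfl

/-- swap the letters if `s` -/
def sww (s : Bool) (w : List Bool) : List Bool := w.map (xor s)

/-- degree of a word -/
def dg : List Bool → ℕ
  | [] => 0
  | b :: w => (if b then 100 else 1) + dg w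

/-- the certificate check -/
def cchk (s : Bool) (t : List Bool) (pts : List (ℤ × Q4 (Q4 ℤ))) : Bool :=
  !(Nat.beq (dg (sww s t)) 0) &&
  pts.all (fun p => gw32.all fun u => Nat.blt (dg (sww s t)) (3 * dg (sww s u)) ||
    decide (qtr p.2 (sww s u) = 0)) &&
  gw32.all (fun u => decide (u = t) || !(Nat.beq (dg (sww s t)) (dg (sww s u))) ||
    decide ((pts.map fun p => p.1 * qtr p.2 (sww s u)).sum = 0)) &&
  gw32.all (fun u => gw32.all fun v =>
    !(Nat.beq (dg (sww s t)) (dg (sww s u) + dg (sww s v))) ||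
    decide ((pts.map fun p => p.1 * (qtr p.2 (sww s u) * qtr p.2 (sww s v))).sum = 0)) &&
  !(decide ((pts.map fun p => p.1 * qtr p.2 (sww s t)).sum = 0))

/-- the data for checking -/
def cdat : List (List Bool × Bool × List (ℤ × Q4 (Q4 ℤ))) := [
  ([true], false,
    [(1, ((1, 0, 0, 0), (0, 0, 0, 0), (0, 0, 0, 0), (0, 0, 0, 0)))]),
  ([false], true,
    [(1, ((1, 0, 0, 0), (0, 0, 0, 0), (0, 0, 0, 0), (0, 0, 0, 0)))]),
  ([false, true], false,
    [(1, ((0, 0, 0, 0), (1, 0, 0, 0), (0, 0, 0, 0), (0, 0, 0, 0)))]),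
  ([false, false, true], false,
    [(1, ((0, 0, 0, 0), (0, 0, 0, 0), (1, 0, 0, 0), (0, 0, 0, 0)))]),
  ([false, true, true], true,
    [(1, ((0, 0, 0, 0), (0, 0, 0, 0), (1, 0, 0, 0), (0, 0, 0, 0)))]),
  ([false, false, false, true], false,
    [(1, ((0, 0, 0, 0), (0, 0, 0, 0), (0, 0, 0, 0), (1, 0, 0, 0)))]),
  ([false, true, true, true], true,
    [(1, ((0, 0, 0, 0), (0, 0, 0, 0), (0, 0, 0, 0), (1, 0, 0, 0)))]),
  ([false, false, true, true], false,
    [(1, ((0, 0, 0, 1), (0, 1, 0, 0), (1, 0, 1, 1), (0, -1, 0, -2)))]),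
  ([false, true, false, true], false,
    [(1, ((0, 0, 0, 0), (-1, 0, 0, 0), (0, 0, 0, 0), (0, 0, 1, 0)))]),
  ([false, false, true, false, false, true], false,
    [(1, ((0, 1, 0, 0), (0, -1, -1, 0), (1, 0, 0, -1), (0, -1, 0, 1)))]),
  ([true, true, false, true, true, false], true,
    [(1, ((0, 1, 0, 0), (0, -1, -1, 0), (1, 0, 0, -1), (0, -1, 0, 1)))]),
  ([false, false, false, true, true], false,
    [(1, ((0, -1, -1, -1), (-1, 0, 0, 0), (1, 0, 0, 0), (0, -1, 1, 0)))]),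
  ([true, true, true, false, false], true,
    [(1, ((0, -1, -1, -1), (-1, 0, 0, 0), (1, 0, 0, 0), (0, -1, 1, 0)))]),
  ([false, false, true, true, false, true], false,
    [(1, ((0, 0, 0, 0), (0, 1, 1, -1), (1, 0, 0, -1), (0, -1, 0, -1)))]),
  ([true, true, false, false, true, false], false,
    [(1, ((0, 0, 0, 0), (0, 1, 0, 0), (-1, 1, 0, 0), (0, 1, -1, -1)))]),
  ([false, false, false, true, true, false, true], false,
    [(1, ((0, -1, 0, 1), (1, -1, 0, 0), (-1, 0, -1, 1), (0, 1, -1, 2)))]),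
  ([true, true, true, false, false, true, false], true,
    [(1, ((0, -1, 0, 1), (1, -1, 0, 0), (-1, 0, -1, 1), (0, 1, -1, 2)))]),
  ([false, false, false, true, true, false, false, true], false,
    [(1, ((-1, 1, 0, 0), (-1, 1, 0, 0), (-1, -1, 0, 1), (0, 1, 2, 0)))]),
  ([true, true, true, false, false, true, true, false], true,
    [(1, ((-1, 1, 0, 0), (-1, 1, 0, 0), (-1, -1, 0, 1), (0, 1, 2, 0)))]),
  ([false, false, false, true, true, true, false, true], false,
    [(-1, ((1, -1, -1, 0), (0, -1, 0, 1), (-1, 1, 0, 0), (0, 1, -1, 0))), (1, ((0, 0, 0, -1), (0, 1, 0, 0), (-1, 1, -2, 0), (0, 1, -1, 1)))]),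
  ([true, true, true, false, false, false, true, false], false,
    [(-1, ((-1, -1, 1, 0), (-1, 1, 1, 0), (-1, 1, -1, 0), (0, 1, 0, 1))), (1, ((2, 1, -1, 0), (0, -1, 0, 0), (-1, 1, -1, 1), (0, 1, -1, 0)))]),
  ([false, false, false, true, false, false, true, false, true], false,
    [(1, ((0, 0, 0, 0), (-1, 0, 1, 0), (-1, -1, 1, -1), (0, 1, 2, -1)))]),
  ([true, true, true, false, true, true, false, true, false], true,
    [(1, ((0, 0, 0, 0), (-1, 0, 1, 0), (-1, -1, 1, -1), (0, 1, 2, -1)))]),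
  ([false, false, true, true, false, true, false, false, true], false,
    [(1, ((0, 0, 1, 1), (0, 0, -1, 0), (1, 0, 0, 0), (0, -1, 0, 0)))]),
  ([true, true, false, false, true, false, true, true, false], true,
    [(1, ((0, 0, 1, 1), (0, 0, -1, 0), (1, 0, 0, 0), (0, -1, 0, 0)))]),
  ([false, false, false, true, true, true, false, false, true, true], false,
    [(-6, ((0, 0, 0, 0), (0, 0, 0, 0), (1, -1, 0, 1), (0, -1, 1, 0))), (-1, ((0, 1, 0, -1), (1, 0, -1, 0), (-1, 0, 1, -1), (0, 1, -1, -1)))]),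
  ([true, true], false,
    [(1, ((0, -1, 0, 0), (0, 1, 1, 1), (1, 0, 0, 1), (0, 1, 1, -1)))]),
  ([false, false], true,
    [(1, ((0, -1, 0, 0), (0, 1, 1, 1), (1, 0, 0, 1), (0, 1, 1, -1)))]),
  ([true, true, true], false,
    [(1, ((-1, 1, 0, -1), (-1, 0, 1, 0), (0, 0, 0, -1), (1, -1, 0, 1)))]),
  ([false, false, false], true,
    [(1, ((-1, 1, 0, -1), (-1, 0, 1, 0), (0, 0, 0, -1), (1, -1, 0, 1)))]),
  ([true, true, true, true], false,
    [(1, ((0, 1, 1, -1), (0, 0, 0, 1), (1, 0, 0, 0), (0, -1, 0, 0)))]),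
  ([false, false, false, false], true,
    [(1, ((0, 1, 1, -1), (0, 0, 0, 1), (1, 0, 0, 0), (0, -1, 0, 0)))])]

theorem cdat_ok : cdat.all (fun d => cchk d.2.1 d.1 d.2.2) = true := by decide +kernel

theorem cdat_all : gw32.all (fun w => (cdat.map Prod.fst).contains w) = true := by decide +kernel

theorem cert_int (s : Bool) (t : List Bool) (pts : List (ℤ × Q4 (Q4 ℤ)))
    (h : cchk s t pts = true) (ws : List (List Bool)) (hw : ∀ u ∈ ws, u ∈ gw32 ∧ u ≠ t) :
    (pts.map fun p => p.1 * (if dg (sww s t) = (ws.map fun u => dg (sww s u)).sum then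
      (ws.map fun u => qtr p.2 (sww s u)).prod else 0)).sum = 0 := by
  simp only [cchk, Bool.and_eq_true, List.all_eq_true, Bool.or_eq_true, decide_eq_true_eq,
    Bool.not_eq_true', decide_eq_false_iff_not] at h
  obtain ⟨⟨⟨⟨h0, h1⟩, h2⟩, h3⟩, _⟩ := h
  by_cases hs : dg (sww s t) = (ws.map fun u => dg (sww s u)).sum
  swap
  · simp [hs]
  simp only [if_pos hs]
  match ws, hw, hs with
  | [], _, hs =>
    simp only [List.map_nil, List.sum_nil] at hs
    rw [hs] at h0
    simp at h0
  | [u], hw, hs =>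
    simp only [List.map_cons, List.map_nil, List.sum_cons, List.sum_nil, add_zero] at hs
    obtain ⟨hu, hut⟩ := hw u (by simp)
    rcases h2 u hu with (h | h) | h
    · exact absurd h hut
    · rw [hs] at h; simp at h
    · simpa using h
  | [u, v], hw, hs =>
    simp only [List.map_cons, List.map_nil, List.sum_cons, List.sum_nil, add_zero] at hs
    rcases h3 u (hw u (by simp)).1 v (hw v (by simp)).1 with h | h
    · rw [hs] at h; simp at h
    · simpa using h
  | u :: v :: x :: r, hw, hs =>
    simp only [List.map_cons, List.sum_cons] at hs
    apply List.sum_eq_zero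
    intro z hz
    obtain ⟨p, hp, rfl⟩ := List.mem_map.1 hz
    have hu := h1 p hp u (hw u (by simp)).1
    have hv := h1 p hp v (hw v (by simp)).1
    have hx := h1 p hp x (hw x (by simp)).1
    simp only [List.map_cons, List.prod_cons]
    rcases hu with hu | hu
    · rcases hv with hv | hv
      · rcases hx with hx | hx
        · simp only [Nat.blt_eq] at hu hv hx
          omega
        · simp [hx]
      · simp [hv]
    · simp [hu]

theorem wd_scale {R : Type*} [CommRing R] {n : ℕ} (a : R) (A B : Matrix (Fin n) (Fin n) R)
    (w : List Bool) : wd (a • A) (a ^ 100 • B) w = a ^ dg w • wd A B w := by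
  induction w with
  | nil => simp [wd, dg]
  | cons b w ih =>
    simp only [wd, List.map_cons, List.prod_cons] at ih ⊢
    rw [ih, dg]
    cases b <;> simp [pow_add, smul_smul, mul_comm]

theorem wd_swap {R : Type*} [CommRing R] {n : ℕ} (M : Bool → Matrix (Fin n) (Fin n) R) (s : Bool)
    (w : List Bool) : wd (M s) (M (!s)) w = wd (M false) (M true) (sww s w) := by
  simp only [wd, sww, List.map_map]
  congr 2
  funext b
  cases b <;> cases s <;> simp

/-- the scaled matrices -/
def scm {R : Type*} [CommRing R] (a : R) (M : Q4 (Q4 ℤ)) (b : Bool) : Matrix (Fin 4) (Fin 4) R :=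
  if b then a ^ 100 • (qm M).map (Int.castRingHom _) else a • jm.map (Int.castRingHom _)

theorem scm_trace {R : Type*} [CommRing R] (a : R) (M : Q4 (Q4 ℤ)) (w : List Bool) :
    (wd (scm a M false) (scm a M true) w).trace = (qtr M w : R) * a ^ dg w := by
  rw [scm, scm, if_pos rfl, if_neg Bool.false_ne_true, wd_scale, ← wd_map, Matrix.trace_smul,
    ← AddMonoidHom.map_trace, ← qtr_eq, smul_eq_mul, mul_comm]
  rfl

/-- the test homomorphism -/
def tst (K : Type*) [Field K] (M : Q4 (Q4 ℤ)) (s : Bool) :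
    MvPolynomial (MatVar 4) K →ₐ[K] Polynomial K :=
  aeval (pairSub (scm (Polynomial.X : Polynomial K) M s) (scm (Polynomial.X : Polynomial K) M (!s)))

theorem tst_wd (K : Type*) [Field K] (M : Q4 (Q4 ℤ)) (s : Bool) (w : List Bool) :
    tst K M s (wd (genX K 4) (genY K 4) w).trace =
      (qtr M (sww s w) : Polynomial K) * Polynomial.X ^ dg (sww s w) := by
  have h1 := wd_map (tst K M s : MvPolynomial (MatVar 4) K →+* Polynomial K)
    (genX K 4) (genY K 4) w
  have h2 : (genX K 4).map (tst K M s : MvPolynomial (MatVar 4) K →+* Polynomial K) =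
      scm (Polynomial.X : Polynomial K) M s := by
    ext1 i j; simp [genX, tst, pairSub]
  have h3 : (genY K 4).map (tst K M s : MvPolynomial (MatVar 4) K →+* Polynomial K) =
      scm (Polynomial.X : Polynomial K) M (!s) := by
    ext1 i j; simp [genY, tst, pairSub]
  rw [h2, h3, wd_swap] at h1
  have h4 := AddMonoidHom.map_trace (tst K M s : MvPolynomial (MatVar 4) K →+* Polynomial K)
    (wd (genX K 4) (genY K 4) w)
  rw [h1, scm_trace] at h4
  exact h4

/-- the test functional -/
def lam (K : Type*) [Field K] (s : Bool) (pts : List (ℤ × Q4 (Q4 ℤ))) (N : ℕ)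
    (f : MvPolynomial (MatVar 4) K) : K :=
  (pts.map fun p => (p.1 : K) * (tst K p.2 s f).coeff N).sum

theorem lam_prod (K : Type*) [Field K] (s : Bool) (pts : List (ℤ × Q4 (Q4 ℤ))) (N : ℕ)
    (ws : List (List Bool)) :
    lam K s pts N (ws.map fun w => (wd (genX K 4) (genY K 4) w).trace).prod =
    (((pts.map fun p => p.1 * (if N = (ws.map fun u => dg (sww s u)).sum then
      (ws.map fun u => qtr p.2 (sww s u)).prod else 0)).sum : ℤ) : K) := by
  have h : ∀ M : Q4 (Q4 ℤ), tst K M s (ws.map fun w => (wd (genX K 4) (genY K 4) w).trace).prod =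
      Polynomial.C (((ws.map fun u => qtr M (sww s u)).prod : ℤ) : K) *
        Polynomial.X ^ (ws.map fun u => dg (sww s u)).sum := by
    intro M
    induction ws with
    | nil => simp
    | cons w ws ih =>
      simp only [List.map_cons, List.prod_cons, List.sum_cons, map_mul] at ih ⊢
      rw [ih, tst_wd]
      push_cast
      rw [map_mul, pow_add, map_intCast]
      ring
  rw [lam, Int.cast_list_sum, List.map_map]
  congr 2
  funext p
  simp only [Function.comp_apply, h, Polynomial.coeff_C_mul_X_pow]
  split_ifs <;> simp

theorem cert_sound (K : Type*) [Field K] [CharZero K] (s : Bool) (t : List Bool)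
    (pts : List (ℤ × Q4 (Q4 ℤ))) (h : cchk s t pts = true) :
    (wd (genX K 4) (genY K 4) t).trace ∉
      Algebra.adjoin K {f | ∃ u ∈ gw32, u ≠ t ∧ f = (wd (genX K 4) (genY K 4) u).trace} := by
  intro hmem
  have h1 : ∀ f ∈ Algebra.adjoin K
      {f | ∃ u ∈ gw32, u ≠ t ∧ f = (wd (genX K 4) (genY K 4) u).trace},
      lam K s pts (dg (sww s t)) f = 0 := by
    intro f hf
    rw [← Subalgebra.mem_toSubmodule, Algebra.adjoin_eq_span] at hf
    induction hf using Submodule.span_induction with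
    | mem x hx =>
      have h2 : ∃ ws : List (List Bool), (∀ u ∈ ws, u ∈ gw32 ∧ u ≠ t) ∧
          x = (ws.map fun w => (wd (genX K 4) (genY K 4) w).trace).prod := by
        induction hx using Submonoid.closure_induction with
        | mem x hx =>
          obtain ⟨u, hu, hut, rfl⟩ := hx
          exact ⟨[u], by simpa using ⟨hu, hut⟩, by simp⟩
        | one => exact ⟨[], by simp, by simp⟩
        | mul x y _ _ hx hy =>
          obtain ⟨a, ha, rfl⟩ := hx
          obtain ⟨b, hb, rfl⟩ := hy
          refine ⟨a ++ b, ?_, by simp⟩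
          intro u hu
          rcases List.mem_append.1 hu with hu | hu
          · exact ha u hu
          · exact hb u hu
      obtain ⟨ws, hws, rfl⟩ := h2
      rw [lam_prod, cert_int s t pts h ws hws, Int.cast_zero]
    | zero => simp [lam]
    | add x y _ _ hx hy =>
      have : lam K s pts (dg (sww s t)) (x + y) = lam K s pts (dg (sww s t)) x +
          lam K s pts (dg (sww s t)) y := by
        simp [lam, mul_add, List.sum_map_add]
      rw [this, hx, hy, add_zero]
    | smul a x _ hx =>
      have : lam K s pts (dg (sww s t)) (a • x) = a * lam K s pts (dg (sww s t)) x := by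
        simp only [lam, map_smul, Polynomial.coeff_smul, smul_eq_mul, ← List.sum_map_mul_left]
        congr 2
        funext p
        ring
      rw [this, hx, mul_zero]
  have h2 := h1 _ hmem
  have h3 := lam_prod K s pts (dg (sww s t)) [t]
  simp only [List.map_cons, List.map_nil, List.prod_cons, List.prod_nil, mul_one, List.sum_cons,
    List.sum_nil, add_zero, if_true] at h3
  rw [h2] at h3
  have h4 := Int.cast_eq_zero.1 h3.symm
  simp only [cchk, Bool.and_eq_true, Bool.not_eq_true', decide_eq_false_iff_not] at h
  exact h.2 h4

theorem minimal_part (K : Type*) [Field K] [CharZero K] (T : Set (MvPolynomial (MatVar 4) K))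
    (hT : T ⊂ Set.range (gens32 K)) : Algebra.adjoin K T ≠ pureAlg K 4 := by
  intro heq
  obtain ⟨hsub, hne⟩ := hT
  obtain ⟨_, ⟨i, rfl⟩, hi⟩ := Set.not_subset.1 hne
  have ht : gw32.getD i [] ∈ gw32 := by
    rw [List.getD_eq_getElem _ _ (by exact i.2)]
    exact List.getElem_mem _
  have h1 := cdat_all
  rw [List.all_eq_true] at h1
  have h2 := h1 _ ht
  rw [List.contains_iff_mem] at h2
  obtain ⟨⟨t, s, pts⟩, hd, h3⟩ := List.mem_map.1 h2
  have h4 := cdat_ok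
  rw [List.all_eq_true] at h4
  have h5 := h4 _ hd
  dsimp only at h3 h5
  subst h3
  apply cert_sound K s _ pts h5
  have h6 : gens32 K i ∈ Algebra.adjoin K T := by
    rw [heq, gens32_gw]
    exact wd_mem _
  rw [← gens32_gw]
  refine Algebra.adjoin_mono ?_ h6
  intro f hf
  obtain ⟨j, rfl⟩ := hsub hf
  refine ⟨gw32.getD j [], ?_, ?_, gens32_gw K j⟩
  · rw [List.getD_eq_getElem _ _ (by exact j.2)]
    exact List.getElem_mem _
  · intro hji
    apply hi
    rw [gens32_gw, ← hji, ← gens32_gw]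
    exact hf

/-- The traces of the 32 words listed in `gens32` form a minimal generating set of the
`K`-algebra `C_{4,2}`: they generate it as a unital `K`-algebra and no proper subset of
them does. -/
theorem minimal_generators_C42 (K : Type*) [Field K] [CharZero K] :
    Algebra.adjoin K (Set.range (gens32 K)) = pureAlg K 4 ∧
    ∀ T : Set (MvPolynomial (MatVar 4) K), T ⊂ Set.range (gens32 K) →
      Algebra.adjoin K T ≠ pureAlg K 4 := ⟨adjoin_eq K, fun T hT => minimal_part K T hT⟩
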